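/- arXiv:1503.07623 — 7 statements merged into one kernel-verified Lean document; each statement's English description precedes it below -/
import Mathlib

section
/- Let a, b, b', c ∈ ℂ. Let U ⊆ ℂ² be open and let u : ℂ² → ℂ be holomorphic on U and satisfy Appell's system E₁(b, a−b', b', c) in the variables (s,t) on U. Let Ω ⊆ ℂ² be open such that for every (x,y) ∈ Ω one has 1−y ∈ ℂ∖(−∞,0] and (x, x/(1−y)) ∈ U. Then the function z(x,y) := (1−y)^(−b') · u(x, x/(1−y)) satisfies Appell's system E₂(a, b, b', c, a) in the variables (x,y) on Ω. (Proposition 1.3: the system E₂(a,b,b',c,c') with c' = a contains a subsystem isomorphic to E₁.) -/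
noncomputable section

/-- Partial derivative in the first variable. -/
def pdx (f : ℂ → ℂ → ℂ) : ℂ → ℂ → ℂ := fun x y => deriv (fun s => f s y) x

/-- Partial derivative in the second variable. -/
def pdy (f : ℂ → ℂ → ℂ) : ℂ → ℂ → ℂ := fun x y => deriv (fun t => f x t) y

/-- Euler operator `D = x ∂/∂x`. -/
def Dx (f : ℂ → ℂ → ℂ) : ℂ → ℂ → ℂ := fun x y => x * pdx f x y

/-- Euler operator `D' = y ∂/∂y`. -/
def Dy (f : ℂ → ℂ → ℂ) : ℂ → ℂ → ℂ := fun x y => y * pdy f x y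

/-- The operator `P₂` of Appell's system `E₂(a,b,b',c,c')`:
`P₂ z = D(c−1+D)z − x(a+D+D')(b+D)z`. -/
def appellP2 (a b c : ℂ) (z : ℂ → ℂ → ℂ) : ℂ → ℂ → ℂ :=
  fun x y =>
    Dx (fun x y => (c - 1) * z x y + Dx z x y) x y
      - x * (a * (b * z x y + Dx z x y)
        + Dx (fun x y => b * z x y + Dx z x y) x y
        + Dy (fun x y => b * z x y + Dx z x y) x y)

/-- The operator `Q₂` of Appell's system `E₂(a,b,b',c,c')`:
`Q₂ z = D'(c'−1+D')z − y(a+D+D')(b'+D')z`. -/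
def appellQ2 (a b' c' : ℂ) (z : ℂ → ℂ → ℂ) : ℂ → ℂ → ℂ :=
  fun x y =>
    Dy (fun x y => (c' - 1) * z x y + Dy z x y) x y
      - y * (a * (b' * z x y + Dy z x y)
        + Dx (fun x y => b' * z x y + Dy z x y) x y
        + Dy (fun x y => b' * z x y + Dy z x y) x y)

/-- The operator `P₁` of Appell's system `E₁(a,b,b',c)`. -/
def appellP1 (a b b' c : ℂ) (z : ℂ → ℂ → ℂ) : ℂ → ℂ → ℂ :=
  fun x y =>
    x * (1 - x) * pdx (pdx z) x y + y * (1 - x) * pdx (pdy z) x y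
      + (c - (a + b + 1) * x) * pdx z x y - b * y * pdy z x y - a * b * z x y

/-- The operator `Q₁` of Appell's system `E₁(a,b,b',c)`. -/
def appellQ1 (a b b' c : ℂ) (z : ℂ → ℂ → ℂ) : ℂ → ℂ → ℂ :=
  fun x y =>
    y * (1 - y) * pdy (pdy z) x y + x * (1 - y) * pdx (pdy z) x y
      + (c - (a + b' + 1) * y) * pdy z x y - b' * x * pdx z x y - a * b' * z x y

/-- The operator `R₁` of Appell's system `E₁(a,b,b',c)`. -/
def appellR1 (a b b' c : ℂ) (z : ℂ → ℂ → ℂ) : ℂ → ℂ → ℂ :=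
  fun x y => (x - y) * pdx (pdy z) x y - b' * pdx z x y + b * pdy z x y

open Metric Set Filter Topology in
theorem aux_diff_fderiv (f : ℂ × ℂ → ℂ) (U : Set (ℂ × ℂ)) (hU : IsOpen U)
    (hf : DifferentiableOn ℂ f U) (p : ℂ × ℂ) (hp : p ∈ U) (v : ℂ × ℂ) (hv : ‖v‖ ≤ 1) :
    DifferentiableAt ℂ (fun q => fderiv ℂ f q v) p := by
  have hc : ContinuousAt f p := (hf.differentiableAt (hU.mem_nhds hp)).continuousAt
  obtain ⟨R, hR, hRs⟩ := Metric.mem_nhds_iff.1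
    (Filter.inter_mem (hU.mem_nhds hp) (hc (Metric.closedBall_mem_nhds (f p) one_pos)))
  obtain ⟨r, hr, rfl⟩ : ∃ r : ℝ, 0 < r ∧ R = 4 * r := ⟨R / 4, by positivity, by ring⟩
  have hd : DifferentiableOn ℂ f (ball p (4 * r)) := hf.mono fun q hq => (hRs hq).1
  have hb : ∀ q ∈ ball p (4 * r), dist (f q) (f p) ≤ 1 := fun q hq => (hRs hq).2
  have hda : ∀ q ∈ ball p (4 * r), DifferentiableAt ℂ f q := fun q hq =>
    hd.differentiableAt (isOpen_ball.mem_nhds hq)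
  have hin : ∀ q ∈ ball p r, ∀ w : ℂ, ‖w‖ < 2 * r → q + w • v ∈ ball p (3 * r) := by
    intro q hq w hw
    have h1 : ‖w • v‖ ≤ ‖w‖ := by
      rw [norm_smul]; nlinarith [norm_nonneg w, norm_nonneg v]
    rw [mem_ball, dist_eq_norm] at hq ⊢
    calc ‖q + w • v - p‖ = ‖(q - p) + w • v‖ := by congr 1; abel
      _ ≤ ‖q - p‖ + ‖w • v‖ := norm_add_le _ _
      _ < 3 * r := by linarith
  have hin4 : ∀ q ∈ ball p r, ∀ w : ℂ, ‖w‖ < 2 * r → q + w • v ∈ ball p (4 * r) :=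
    fun q hq w hw => ball_subset_ball (by linarith) (hin q hq w hw)
  have hcm : ∀ θ : ℝ, ‖circleMap 0 r θ‖ < 2 * r := by
    intro θ
    rw [norm_circleMap_zero, abs_of_pos hr]; linarith
  have hbd : ∀ q ∈ ball p (3 * r), ‖fderiv ℂ f q‖ ≤ 2 / r := by
    intro q hq
    have hsub : ball q r ⊆ ball p (4 * r) := by
      apply ball_subset_ball'
      rw [mem_ball] at hq; linarith
    apply Complex.norm_fderiv_le_div_of_mapsTo_ball (hd.mono hsub) _ hr
    intro q' hq'
    have h1 := hb q' (hsub hq')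
    have h2 := hb q (hsub (mem_ball_self hr))
    rw [mem_closedBall]
    linarith [dist_triangle_right (f q') (f q) (f p)]
  set k : ℝ → ℂ := fun θ => deriv (circleMap 0 r) θ * ((circleMap 0 r θ - 0) ^ 2)⁻¹ with hk
  have hkc : Continuous k := by
    have : ∀ θ, circleMap 0 r θ ≠ 0 := fun θ => circleMap_ne_center hr.ne'
    simp only [hk, deriv_circleMap, sub_zero]
    refine Continuous.mul (by fun_prop) (Continuous.inv₀ (by fun_prop) fun θ => pow_ne_zero _ (this θ))
  have key : ∀ q ∈ ball p r, fderiv ℂ f q v = (2 * Real.pi * Complex.I : ℂ)⁻¹ *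
      ∫ θ in (0:ℝ)..2 * Real.pi, k θ * f (q + circleMap 0 r θ • v) := by
    intro q hq
    have hder : HasDerivAt (fun w : ℂ => f (q + w • v)) (fderiv ℂ f q v) 0 := by
      have h1 : HasFDerivAt f (fderiv ℂ f q) (q + (0 : ℂ) • v) := by
        have := (hda q (ball_subset_ball (by linarith) hq)).hasFDerivAt
        simpa using this
      have h2 : HasDerivAt (fun w : ℂ => q + w • v) v 0 := by
        simpa using ((hasDerivAt_id (0 : ℂ)).smul_const v).const_add q
      exact h1.comp_hasDerivAt 0 h2
    have hdo : DifferentiableOn ℂ (fun w : ℂ => f (q + w • v)) (ball 0 (2 * r)) := by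
      intro w hw
      have h1 := hda _ (hin4 q hq w (by simpa using hw))
      have h2 : DifferentiableAt ℂ (fun w : ℂ => q + w • v) w := by fun_prop
      exact (DifferentiableAt.comp w h1 h2).differentiableWithinAt
    have := Complex.cderiv_eq_deriv isOpen_ball hdo hr (closedBall_subset_ball (by linarith))
    rw [hder.deriv] at this
    rw [← this, Complex.cderiv, circleIntegral, smul_eq_mul]
    simp only [smul_eq_mul, hk, mul_assoc]
  have hFc : ∀ q ∈ ball p r, Continuous fun θ => k θ * f (q + circleMap 0 r θ • v) := by
    intro q hq
    refine hkc.mul (continuous_iff_continuousAt.2 fun θ => ?_)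
    refine ContinuousAt.comp (f := fun θ : ℝ => q + circleMap 0 r θ • v) (g := f)
      (hda _ (hin4 q hq _ (hcm θ))).continuousAt ?_
    fun_prop
  have main : HasFDerivAt (fun q => ∫ θ in (0:ℝ)..2 * Real.pi, k θ * f (q + circleMap 0 r θ • v))
      (∫ θ in (0:ℝ)..2 * Real.pi, k θ • fderiv ℂ f (p + circleMap 0 r θ • v)) p := by
    refine intervalIntegral.hasFDerivAt_integral_of_dominated_of_fderiv_le
      (F' := fun q θ => k θ • fderiv ℂ f (q + circleMap 0 r θ • v))
      (bound := fun θ => ‖k θ‖ * (2 / r)) (s := ball p r)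
      (ball_mem_nhds p hr) ?_ ?_ ?_ ?_ ?_ ?_
    · filter_upwards [ball_mem_nhds p hr] with q hq
      exact (hFc q hq).aestronglyMeasurable
    · exact (hFc p (mem_ball_self hr)).intervalIntegrable _ _
    · refine MeasureTheory.AEStronglyMeasurable.smul hkc.aestronglyMeasurable ?_
      refine Measurable.aestronglyMeasurable ?_
      refine (measurable_fderiv ℂ f).comp (Continuous.measurable ?_)
      fun_prop
    · refine Eventually.of_forall fun θ _ q hq => ?_
      rw [norm_smul]
      exact mul_le_mul_of_nonneg_left (hbd _ (hin q hq _ (hcm θ))) (norm_nonneg _)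
    · exact (hkc.norm.mul continuous_const).intervalIntegrable _ _
    · refine Eventually.of_forall fun θ _ q hq => ?_
      have h1 := (hda _ (hin4 q hq _ (hcm θ))).hasFDerivAt
      have h2 : HasFDerivAt (fun q : ℂ × ℂ => q + circleMap 0 r θ • v)
          (ContinuousLinearMap.id ℂ (ℂ × ℂ)) q := (hasFDerivAt_id q).add_const _
      exact (h1.comp q h2).const_mul (k θ)
  refine (main.differentiableAt.const_mul ((2 * Real.pi * Complex.I : ℂ)⁻¹)).congr_of_eventuallyEq ?_
  filter_upwards [ball_mem_nhds p hr] with q hq using key q hq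

theorem aux_pdx_eq (f : ℂ → ℂ → ℂ) (x y : ℂ)
    (h : DifferentiableAt ℂ (fun p : ℂ × ℂ => f p.1 p.2) (x, y)) :
    pdx f x y = fderiv ℂ (fun p : ℂ × ℂ => f p.1 p.2) (x, y) (1, 0) := by
  have h2 : HasDerivAt (fun s : ℂ => (s, y)) ((1 : ℂ), (0 : ℂ)) x :=
    (hasDerivAt_id x).prodMk (hasDerivAt_const x y)
  exact (h.hasFDerivAt.comp_hasDerivAt x h2).deriv

theorem aux_pdy_eq (f : ℂ → ℂ → ℂ) (x y : ℂ)
    (h : DifferentiableAt ℂ (fun p : ℂ × ℂ => f p.1 p.2) (x, y)) :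
    pdy f x y = fderiv ℂ (fun p : ℂ × ℂ => f p.1 p.2) (x, y) (0, 1) := by
  have h2 : HasDerivAt (fun s : ℂ => (x, s)) ((0 : ℂ), (1 : ℂ)) y :=
    (hasDerivAt_const y x).prodMk (hasDerivAt_id y)
  exact (h.hasFDerivAt.comp_hasDerivAt y h2).deriv

theorem aux_clm (L : ℂ × ℂ →L[ℂ] ℂ) (s t : ℂ) : L (s, t) = L (1, 0) * s + L (0, 1) * t := by
  have : ((s, t) : ℂ × ℂ) = s • ((1 : ℂ), (0 : ℂ)) + t • ((0 : ℂ), (1 : ℂ)) := by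
    ext <;> simp
  rw [this, map_add, map_smul, map_smul, smul_eq_mul, smul_eq_mul]; ring

/-- chain rule -/
theorem aux_chain (f : ℂ → ℂ → ℂ) (α β : ℂ → ℂ) (α' β' r : ℂ)
    (h : DifferentiableAt ℂ (fun p : ℂ × ℂ => f p.1 p.2) (α r, β r))
    (hα : HasDerivAt α α' r) (hβ : HasDerivAt β β' r) :
    HasDerivAt (fun s => f (α s) (β s)) (pdx f (α r) (β r) * α' + pdy f (α r) (β r) * β') r := by
  rw [aux_pdx_eq f _ _ h, aux_pdy_eq f _ _ h, ← aux_clm]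
  exact HasFDerivAt.comp_hasDerivAt (f := fun s => (α s, β s)) r h.hasFDerivAt (hα.prodMk hβ)

theorem aux_pd (u : ℂ → ℂ → ℂ) (U : Set (ℂ × ℂ)) (hU : IsOpen U)
    (hu : DifferentiableOn ℂ (fun p : ℂ × ℂ => u p.1 p.2) U) (p : ℂ × ℂ) (hp : p ∈ U) :
    DifferentiableAt ℂ (fun p : ℂ × ℂ => u p.1 p.2) p ∧
    DifferentiableAt ℂ (fun p : ℂ × ℂ => pdx u p.1 p.2) p ∧
    DifferentiableAt ℂ (fun p : ℂ × ℂ => pdy u p.1 p.2) p ∧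
    pdy (pdx u) p.1 p.2 = pdx (pdy u) p.1 p.2 := by
  set f : ℂ × ℂ → ℂ := fun p => u p.1 p.2 with hf
  have hda : ∀ q ∈ U, DifferentiableAt ℂ f q := fun q hq => hu.differentiableAt (hU.mem_nhds hq)
  have d1 := aux_diff_fderiv f U hU hu p hp (1, 0) (by simp [Prod.norm_def])
  have d2 := aux_diff_fderiv f U hU hu p hp (0, 1) (by simp [Prod.norm_def])
  have e1 : (fun p : ℂ × ℂ => pdx u p.1 p.2) =ᶠ[nhds p] fun q => fderiv ℂ f q (1, 0) := by
    filter_upwards [hU.mem_nhds hp] with q hq using aux_pdx_eq u q.1 q.2 (hda q hq)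
  have e2 : (fun p : ℂ × ℂ => pdy u p.1 p.2) =ᶠ[nhds p] fun q => fderiv ℂ f q (0, 1) := by
    filter_upwards [hU.mem_nhds hp] with q hq using aux_pdy_eq u q.1 q.2 (hda q hq)
  have d1' := d1.congr_of_eventuallyEq e1
  have d2' := d2.congr_of_eventuallyEq e2
  refine ⟨hda p hp, d1', d2', ?_⟩
  rw [aux_pdy_eq (pdx u) p.1 p.2 d1', aux_pdx_eq (pdy u) p.1 p.2 d2']
  change fderiv ℂ _ p _ = fderiv ℂ _ p _
  rw [e1.fderiv_eq, e2.fderiv_eq]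
  have hF : DifferentiableAt ℂ (fderiv ℂ f) p := by
    have : fderiv ℂ f = fun q => fderiv ℂ f q (1, 0) • ContinuousLinearMap.fst ℂ ℂ ℂ
        + fderiv ℂ f q (0, 1) • ContinuousLinearMap.snd ℂ ℂ ℂ := by
      funext q
      apply ContinuousLinearMap.ext
      rintro ⟨s, t⟩
      rw [aux_clm]; simp
    rw [this]
    exact (d1.smul_const _).add (d2.smul_const _)
  have sym := second_derivative_symmetric_of_eventually (𝕜 := ℂ) (f := f) (f' := fderiv ℂ f)
    (by filter_upwards [hU.mem_nhds hp] with q hq using (hda q hq).hasFDerivAt) hF.hasFDerivAt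
    (1, 0) (0, 1)
  have ev : ∀ v w, fderiv ℂ (fun q => fderiv ℂ f q v) p w = fderiv ℂ (fderiv ℂ f) p w v := by
    intro v w
    rw [fderiv_clm_apply hF (differentiableAt_const v)]
    simp
  rw [ev, ev, sym]

/-- z-type functions and their partial derivatives -/
theorem aux_zx (g : ℂ → ℂ → ℂ) (e x y : ℂ)
    (hg : DifferentiableAt ℂ (fun p : ℂ × ℂ => g p.1 p.2) (x, x / (1 - y))) :
    HasDerivAt (fun s => (1 - y) ^ e * g s (s / (1 - y)))
      ((1 - y) ^ e * (pdx g x (x / (1 - y)) + pdy g x (x / (1 - y)) / (1 - y))) x := by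
  have := aux_chain g (fun s => s) (fun s => s / (1 - y)) 1 (1 / (1 - y)) x hg
    (hasDerivAt_id x) ((hasDerivAt_id x).div_const _)
  refine (this.const_mul ((1 - y) ^ e)).congr_deriv ?_
  ring

theorem aux_zy (g : ℂ → ℂ → ℂ) (e x y : ℂ) (hy : 1 - y ∈ Complex.slitPlane)
    (hg : DifferentiableAt ℂ (fun p : ℂ × ℂ => g p.1 p.2) (x, x / (1 - y))) :
    HasDerivAt (fun t => (1 - t) ^ e * g x (x / (1 - t)))
      ((1 - y) ^ e * (-e / (1 - y) * g x (x / (1 - y))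
        + x / (1 - y) ^ 2 * pdy g x (x / (1 - y)))) y := by
  have h0 : 1 - y ≠ 0 := Complex.slitPlane_ne_zero hy
  have h1 : HasDerivAt (fun t : ℂ => 1 - t) (-1) y := by
    simpa using (hasDerivAt_id y).const_sub 1
  have h2 : HasDerivAt (fun t : ℂ => x / (1 - t)) (x / (1 - y) ^ 2) y := by
    refine ((hasDerivAt_const y x).div h1 h0).congr_deriv ?_
    ring
  have h3 := h1.cpow_const (c := e) hy
  have := aux_chain g (fun _ => x) (fun t => x / (1 - t)) 0 (x / (1 - y) ^ 2) y hg
    (hasDerivAt_const y x) h2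
  refine (h3.mul this).congr_deriv ?_
  rw [Complex.cpow_sub _ _ h0, Complex.cpow_one]
  field_simp
  ring

/-- Proposition 1.3: if `u` solves Appell's system `E₁(b, a−b', b', c)` on `U`, then
`z(x,y) = (1−y)^(−b') · u(x, x/(1−y))` solves Appell's system `E₂(a, b, b', c, a)` on `Ω`. -/
theorem stmt0 (a b b' c : ℂ) (U : Set (ℂ × ℂ)) (hU : IsOpen U)
    (u : ℂ → ℂ → ℂ)
    (hu : DifferentiableOn ℂ (fun p : ℂ × ℂ => u p.1 p.2) U)
    (hE1 : ∀ p ∈ U, appellP1 b (a - b') b' c u p.1 p.2 = 0 ∧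
      appellQ1 b (a - b') b' c u p.1 p.2 = 0 ∧
      appellR1 b (a - b') b' c u p.1 p.2 = 0)
    (Ω : Set (ℂ × ℂ)) (hΩ : IsOpen Ω)
    (hmem : ∀ p ∈ Ω, (1 - p.2) ∈ Complex.slitPlane ∧ (p.1, p.1 / (1 - p.2)) ∈ U) :
    ∀ p ∈ Ω,
      appellP2 a b c (fun x y => (1 - y) ^ (-b') * u x (x / (1 - y))) p.1 p.2 = 0 ∧
      appellQ2 a b' a (fun x y => (1 - y) ^ (-b') * u x (x / (1 - y))) p.1 p.2 = 0 := by
  intro p hp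
  obtain ⟨x, y⟩ := p
  set z : ℂ → ℂ → ℂ := fun x y => (1 - y) ^ (-b') * u x (x / (1 - y)) with hz
  have hpd := aux_pd u U hU hu
  have hzx : ∀ x y, (x, y) ∈ Ω → pdx z x y = (1 - y) ^ (-b') * pdx u x (x / (1 - y))
      + (1 - y) ^ (-b') * pdy u x (x / (1 - y)) / (1 - y) := by
    intro x y h
    rw [show pdx z x y = _ from (aux_zx u (-b') x y (hpd _ (hmem _ h).2).1).deriv]
    ring
  have hzy : ∀ x y, (x, y) ∈ Ω → pdy z x y = b' * ((1 - y) ^ (-b') * u x (x / (1 - y))) / (1 - y)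
      + x * ((1 - y) ^ (-b') * pdy u x (x / (1 - y))) / (1 - y) ^ 2 := by
    intro x y h
    rw [show pdy z x y = _ from (aux_zy u (-b') x y (hmem _ h).1 (hpd _ (hmem _ h).2).1).deriv]
    ring
  have ex : ∀ᶠ s in nhds x, (s, y) ∈ Ω :=
    (Continuous.prodMk_left (X := ℂ) y).continuousAt.eventually_mem (hΩ.mem_nhds hp)
  have ey : ∀ᶠ t in nhds y, (x, t) ∈ Ω :=
    (Continuous.prodMk_right (Y := ℂ) x).continuousAt.eventually_mem (hΩ.mem_nhds hp)
  obtain ⟨hw, hq⟩ := hmem _ hp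
  simp only at hw hq
  obtain ⟨du, dA, dB, hsym⟩ := hpd _ hq
  simp only at hsym
  have hw0 : 1 - y ≠ 0 := Complex.slitPlane_ne_zero hw
  have ux := aux_zx u (-b') x y du
  have Ax := aux_zx (pdx u) (-b') x y dA
  have Bx := aux_zx (pdy u) (-b') x y dB
  have uy := aux_zy u (-b') x y hw du
  have Ay := aux_zy (pdx u) (-b') x y hw dA
  have By := aux_zy (pdy u) (-b') x y hw dB
  have idx := hasDerivAt_id' x
  have idy := hasDerivAt_id' y
  have wy : HasDerivAt (fun t : ℂ => 1 - t) (-1) y := by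
    simpa using (hasDerivAt_id y).const_sub 1
  have xx : ∀ k : ℂ, pdx (fun x y => k * z x y + Dx z x y) x y = _ := fun k =>
    (((ux.const_mul k).add (idx.mul (Ax.add (Bx.div_const (1 - y))))).congr_of_eventuallyEq (by
      filter_upwards [ex] with s hs
      simp only [Dx, hzx s y hs]; rfl)).deriv
  have yx : ∀ k : ℂ, pdy (fun x y => k * z x y + Dx z x y) x y = _ := fun k =>
    (((uy.const_mul k).add ((Ay.add (By.div wy hw0)).const_mul x)).congr_of_eventuallyEq (by
      filter_upwards [ey] with s hs
      simp only [Dx, hzx x s hs]; rfl)).deriv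
  have xy : ∀ k : ℂ, pdx (fun x y => k * z x y + Dy z x y) x y = _ := fun k =>
    (((ux.const_mul k).add ((((ux.const_mul b').div_const (1 - y)).add
      ((idx.mul Bx).div_const ((1 - y) ^ 2))).const_mul y)).congr_of_eventuallyEq (by
      filter_upwards [ex] with s hs
      simp only [Dy, hzy s y hs]; rfl)).deriv
  have yy : ∀ k : ℂ, pdy (fun x y => k * z x y + Dy z x y) x y = _ := fun k =>
    (((uy.const_mul k).add (idy.mul (((uy.const_mul b').div wy hw0).add
      ((By.const_mul x).div (wy.pow 2) (pow_ne_zero 2 hw0))))).congr_of_eventuallyEq (by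
      filter_upwards [ey] with s hs
      simp only [Dy, hzy x s hs]; rfl)).deriv
  obtain ⟨hP, hQ, hR⟩ := hE1 _ hq
  simp only [appellP1, appellQ1, appellR1] at hP hQ hR
  have hxt : x = x / (1 - y) * (1 - y) := by field_simp
  have hyw : y = 1 - (1 - y) := by ring
  simp only [appellP2, appellQ2]
  have e1 := xx (c - 1)
  have e2 := xx b
  have e3 := yx b
  have e4 := yy (a - 1)
  have e5 := xy b'
  have e6 := yy b'
  have Dxe : ∀ f : ℂ → ℂ → ℂ, Dx f x y = x * pdx f x y := fun f => rfl
  have Dye : ∀ f : ℂ → ℂ → ℂ, Dy f x y = y * pdy f x y := fun f => rfl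
  rw [Dxe (fun x y => (c - 1) * z x y + Dx z x y), Dxe (fun x y => b * z x y + Dx z x y),
    Dye (fun x y => b * z x y + Dx z x y), Dye (fun x y => (a - 1) * z x y + Dy z x y),
    Dxe (fun x y => b' * z x y + Dy z x y), Dye (fun x y => b' * z x y + Dy z x y),
    e1, e2, e3, e4, e5, e6, Dxe, Dye, hzx x y hp, hzy x y hp]
  simp only [hz, hsym, Pi.div_apply, Pi.add_apply, Pi.pow_apply]
  clear e1 e2 e3 e4 e5 e6 xx yx xy yy ux Ax Bx uy Ay By idx idy wy hzx hzy
  clear_value z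
  set t := x / (1 - y) with ht
  generalize (1 - y) ^ (-b') = E
  generalize pdx (pdx u) x t = uss at *
  generalize pdx (pdy u) x t = ust at *
  generalize pdy (pdy u) x t = utt at *
  generalize pdx u x t = us at *
  generalize pdy u x t = ut at *
  generalize u x t = u0 at *
  constructor
  · trans E * (x * (x * (1 - x) * uss + t * (1 - x) * ust + (c - (b + (a - b') + 1) * x) * us
        - (a - b') * t * ut - b * (a - b') * u0)
      + t * (t * (1 - t) * utt + x * (1 - t) * ust + (c - (b + b' + 1) * t) * ut
        - b' * x * us - b * b' * u0))
    · rw [ht]; field_simp; ring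
    · rw [hP, hQ]; ring
  · trans E * y * t * ((x - t) * ust - b' * us + (a - b') * ut)
    · rw [ht]; field_simp; ring
    · rw [hR]; ring
end
end

section
/- Let a, b, b' ∈ ℂ. Let V ⊆ ℂ be open and let w : ℂ → ℂ be holomorphic on V and satisfy the Gauss hypergeometric equation E(b, b', a) on V. Let Ω ⊆ ℂ² be open such that for every (x,y) ∈ Ω one has 1−x ∈ ℂ∖(−∞,0], 1−y ∈ ℂ∖(−∞,0], and xy/((1−x)(1−y)) ∈ V. Then the function z(x,y) := (1−x)^(−b) · (1−y)^(−b') · w( xy/((1−x)(1−y)) ) satisfies Appell's system E₂(a, b, b', a, a) in the variables (x,y) on Ω. (Proposition 1.4: when a = c = c', the system E₂ contains a subsystem isomorphic to the Gauss hypergeometric equation.) -/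
noncomputable section

theorem hd_t (x y : ℂ) (hx : 1 - x ≠ 0) (hy : 1 - y ≠ 0) :
    HasDerivAt (fun s : ℂ => s * y / ((1 - s) * (1 - y))) (y / ((1 - x) ^ 2 * (1 - y))) x := by
  have h1 : HasDerivAt (fun s : ℂ => s * y) (1 * y) x := (hasDerivAt_id x).mul_const y
  have h2 : HasDerivAt (fun s : ℂ => (1 - s) * (1 - y)) ((-1) * (1 - y)) x :=
    ((hasDerivAt_id x).const_sub 1).mul_const (1 - y)
  have h3 := h1.div h2 (mul_ne_zero hx hy)
  refine h3.congr_deriv ?_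
  field_simp
  ring

theorem hd_p (b x : ℂ) (hx : 1 - x ∈ Complex.slitPlane) :
    HasDerivAt (fun s : ℂ => (1 - s) ^ (-b)) ((1 - x) ^ (-b) * (b / (1 - x))) x := by
  have h2 : HasDerivAt (fun s : ℂ => 1 - s) (-1) x := (hasDerivAt_id x).const_sub 1
  have h3 := h2.cpow_const (c := -b) hx
  refine h3.congr_deriv ?_
  rw [Complex.cpow_sub _ _ (Complex.slitPlane_ne_zero hx), Complex.cpow_one]
  ring

theorem hd_z (b x y B : ℂ) (w : ℂ → ℂ) (hx : 1 - x ∈ Complex.slitPlane) (hy : 1 - y ≠ 0)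
    (hw : DifferentiableAt ℂ w (x * y / ((1 - x) * (1 - y)))) :
    HasDerivAt (fun s : ℂ => (1 - s) ^ (-b) * B * w (s * y / ((1 - s) * (1 - y))))
      ((1 - x) ^ (-b) * B * (b / (1 - x) * w (x * y / ((1 - x) * (1 - y)))
        + y / ((1 - x) ^ 2 * (1 - y)) * deriv w (x * y / ((1 - x) * (1 - y))))) x := by
  have hx0 := Complex.slitPlane_ne_zero hx
  have h1 := ((hd_p b x hx).mul_const B).mul
    (HasDerivAt.comp x hw.hasDerivAt (hd_t x y hx0 hy))
  refine h1.congr_deriv ?_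
  simp only [Function.comp]
  ring

theorem hd_t' (x y : ℂ) (hx : 1 - x ≠ 0) (hy : 1 - y ≠ 0) :
    HasDerivAt (fun s : ℂ => x * s / ((1 - x) * (1 - s))) (x / ((1 - y) ^ 2 * (1 - x))) y := by
  have h := hd_t y x hy hx
  have e : (fun s : ℂ => x * s / ((1 - x) * (1 - s))) = fun s : ℂ => s * x / ((1 - s) * (1 - x)) := by
    funext s
    rw [mul_comm x s, mul_comm (1 - x)]
  rw [e]; exact h

theorem P2_zero (a b b' : ℂ) (V : Set ℂ) (hV : IsOpen V)
    (w : ℂ → ℂ) (hw : DifferentiableOn ℂ w V)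
    (hGauss : ∀ t ∈ V,
      t * (1 - t) * deriv (deriv w) t + (a - (b + b' + 1) * t) * deriv w t - b * b' * w t = 0)
    (Ω : Set (ℂ × ℂ)) (hΩ : IsOpen Ω)
    (hmem : ∀ p ∈ Ω, (1 - p.1) ∈ Complex.slitPlane ∧ (1 - p.2) ∈ Complex.slitPlane ∧
      p.1 * p.2 / ((1 - p.1) * (1 - p.2)) ∈ V) (x y : ℂ) (hp : (x, y) ∈ Ω) :
      appellP2 a b a
        (fun x y => (1 - x) ^ (-b) * (1 - y) ^ (-b') * w (x * y / ((1 - x) * (1 - y))))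
        x y = 0 := by
  set z : ℂ → ℂ → ℂ := fun x y =>
    (1 - x) ^ (-b) * (1 - y) ^ (-b') * w (x * y / ((1 - x) * (1 - y))) with hz
  set h : ℂ → ℂ → ℂ := fun x y =>
    (1 - x) ^ (-b) * (1 - y) ^ (-b') * (b / (1 - x) * w (x * y / ((1 - x) * (1 - y)))
        + y / ((1 - x) ^ 2 * (1 - y)) * deriv w (x * y / ((1 - x) * (1 - y)))) with hh
  have hzx : ∀ x y, (x, y) ∈ Ω → HasDerivAt (fun s => z s y) (h x y) x := by
    intro x y hp
    obtain ⟨h1, h2, h3⟩ := hmem _ hp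
    exact hd_z b x y _ w h1 (Complex.slitPlane_ne_zero h2)
      ((hw _ h3).differentiableAt (hV.mem_nhds h3))
  have hD : ∀ x y, (x, y) ∈ Ω → Dx z x y = x * h x y := by
    intro x y hp
    simp only [Dx, pdx]
    rw [(hzx x y hp).deriv]
  obtain ⟨h1, h2, h3⟩ := hmem _ hp
  simp only at h1 h2 h3
  have hx0 := Complex.slitPlane_ne_zero h1
  have hy0 := Complex.slitPlane_ne_zero h2
  have hG := hGauss _ h3
  have hw1 := ((hw _ h3).differentiableAt (hV.mem_nhds h3)).hasDerivAt
  have hw2 := (((hw.deriv hV) _ h3).differentiableAt (hV.mem_nhds h3)).hasDerivAt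
  have ex : ∀ᶠ s in nhds x, (s, y) ∈ Ω :=
    (Continuous.prodMk_left y).continuousAt.eventually (hΩ.mem_nhds hp)
  have ey : ∀ᶠ s in nhds y, (x, s) ∈ Ω :=
    (Continuous.prodMk_right x).continuousAt.eventually (hΩ.mem_nhds hp)
  have hA := hd_p b x h1
  have hB := hd_p b' y h2
  have hT := hd_t x y hx0 hy0
  have hT' := hd_t' x y hx0 hy0
  have w1x := HasDerivAt.comp x hw1 hT
  have w2x := HasDerivAt.comp x hw2 hT
  have w1y := HasDerivAt.comp y hw1 hT'
  have w2y := HasDerivAt.comp y hw2 hT'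
  have ix : HasDerivAt (fun s : ℂ => 1 - s) (-1) x := (hasDerivAt_id x).const_sub 1
  have iy : HasDerivAt (fun s : ℂ => 1 - s) (-1) y := (hasDerivAt_id y).const_sub 1
  have c1 : HasDerivAt (fun s : ℂ => b / (1 - s)) (b / (1 - x) ^ 2) x := by
    refine ((hasDerivAt_const x b).div ix hx0).congr_deriv ?_
    field_simp
    ring
  have c2 : HasDerivAt (fun s : ℂ => y / ((1 - s) ^ 2 * (1 - y))) (2 * y / ((1 - x) ^ 3 * (1 - y))) x := by
    refine ((hasDerivAt_const x y).div ((ix.pow 2).mul_const (1 - y))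
      (mul_ne_zero (pow_ne_zero 2 hx0) hy0)).congr_deriv ?_
    simp only [Pi.pow_apply]
    field_simp
    ring
  have c3 : HasDerivAt (fun s : ℂ => s / ((1 - x) ^ 2 * (1 - s))) (1 / ((1 - x) ^ 2 * (1 - y) ^ 2)) y := by
    refine ((hasDerivAt_id y).div (iy.const_mul ((1 - x) ^ 2))
      (mul_ne_zero (pow_ne_zero 2 hx0) hy0)).congr_deriv ?_
    simp only [id]
    field_simp
    ring
  have hhx := (hA.mul_const ((1 - y) ^ (-b'))).mul ((c1.mul w1x).add (c2.mul w2x))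
  have hhy := (hB.const_mul ((1 - x) ^ (-b))).mul ((w1y.const_mul (b / (1 - x))).add (c3.mul w2y))
  have hzy := (hB.const_mul ((1 - x) ^ (-b))).mul w1y
  have Ex : ∀ k : ℂ, HasDerivAt (fun s => k * z s y + Dx z s y) _ x := fun k =>
    (((hzx x y hp).const_mul k).add ((hasDerivAt_id x).mul hhx)).congr_of_eventuallyEq (by
      filter_upwards [ex] with s hs
      rw [hD s y hs]
      rfl)
  have Ey : HasDerivAt (fun s => b * z x s + Dx z x s) _ y :=
    ((hzy.const_mul b).add (hhy.const_mul x)).congr_of_eventuallyEq (by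
      filter_upwards [ey] with s hs
      rw [hD x s hs]
      rfl)
  have E1 := (Ex (a - 1)).deriv
  have E2 := (Ex b).deriv
  have E3 := Ey.deriv
  simp only [appellP2]
  rw [show Dx (fun x y => (a - 1) * z x y + Dx z x y) x y
    = x * deriv (fun s => (a - 1) * z s y + Dx z s y) x from rfl,
    show Dx (fun x y => b * z x y + Dx z x y) x y
    = x * deriv (fun s => b * z s y + Dx z s y) x from rfl,
    show Dy (fun x y => b * z x y + Dx z x y) x y
    = y * deriv (fun s => b * z x s + Dx z x s) y from rfl, E1, E2, E3, hD x y hp]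
  clear E1 E2 E3 Ex Ey hhx hhy hzy
  simp only [hz, hh, Function.comp, id, Pi.mul_apply, Pi.add_apply]
  generalize hA' : (1 - x) ^ (-b) = A
  generalize hB' : (1 - y) ^ (-b') = B
  generalize hW2 : deriv (deriv w) (x * y / ((1 - x) * (1 - y))) = W2 at *
  generalize hW1 : deriv w (x * y / ((1 - x) * (1 - y))) = W1 at *
  generalize hW0 : w (x * y / ((1 - x) * (1 - y))) = W0 at *
  have key := congrArg (fun q => A * B * (x * y / ((1 - x) * (1 - y))) * q) hG
  simp only [mul_zero] at key
  rw [← key]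
  field_simp
  ring

theorem Q2_eq (a b c : ℂ) (z : ℂ → ℂ → ℂ) (x y : ℂ) :
    appellQ2 a b c z x y = appellP2 a b c (fun x y => z y x) y x := by
  simp only [appellP2, appellQ2, Dx, Dy, pdx, pdy]
  ring

/-- Proposition 1.4: if `w` solves the Gauss hypergeometric equation `E(b, b', a)` on `V`, then
`z(x,y) = (1−x)^(−b) (1−y)^(−b') · w(xy/((1−x)(1−y)))` solves Appell's system
`E₂(a, b, b', a, a)` on `Ω`. -/
theorem stmt1 (a b b' : ℂ) (V : Set ℂ) (hV : IsOpen V)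
    (w : ℂ → ℂ) (hw : DifferentiableOn ℂ w V)
    (hGauss : ∀ t ∈ V,
      t * (1 - t) * deriv (deriv w) t + (a - (b + b' + 1) * t) * deriv w t - b * b' * w t = 0)
    (Ω : Set (ℂ × ℂ)) (hΩ : IsOpen Ω)
    (hmem : ∀ p ∈ Ω, (1 - p.1) ∈ Complex.slitPlane ∧ (1 - p.2) ∈ Complex.slitPlane ∧
      p.1 * p.2 / ((1 - p.1) * (1 - p.2)) ∈ V) :
    ∀ p ∈ Ω,
      appellP2 a b a
        (fun x y => (1 - x) ^ (-b) * (1 - y) ^ (-b') * w (x * y / ((1 - x) * (1 - y))))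
        p.1 p.2 = 0 ∧
      appellQ2 a b' a
        (fun x y => (1 - x) ^ (-b) * (1 - y) ^ (-b') * w (x * y / ((1 - x) * (1 - y))))
        p.1 p.2 = 0 := by
  intro p hp
  refine ⟨P2_zero a b b' V hV w hw hGauss Ω hΩ hmem p.1 p.2 hp, ?_⟩
  rw [Q2_eq]
  have h := P2_zero a b' b V hV w hw (fun t ht => by rw [← hGauss t ht]; ring)
    (Prod.swap ⁻¹' Ω) (hΩ.preimage continuous_swap)
    (fun q hq => by
      obtain ⟨h1, h2, h3⟩ := hmem _ hq
      refine ⟨h2, h1, ?_⟩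
      simp only [Prod.fst_swap, Prod.snd_swap] at h3
      rwa [mul_comm q.1, mul_comm (1 - q.1)]) p.2 p.1 hp
  rw [← h]
  congr 1
  funext x y
  rw [mul_comm y x, mul_comm (1 - y) (1 - x), mul_comm ((1 - y) ^ (-b))]
end
end

section
/- Let a, b, b' ∈ ℂ. Let U ⊆ ℂ² be open and let v : ℂ² → ℂ be holomorphic on U and satisfy Appell's system E₁(b, 0, b', a) in the variables (s,t) on U. Let Ω ⊆ ℂ² be open such that for every (x,y) ∈ Ω one has 1−x ∈ ℂ∖(−∞,0], 1−y ∈ ℂ∖(−∞,0], and (−x/(1−x), xy/((1−x)(1−y))) ∈ U. Then z(x,y) := (1−x)^(−b) · (1−y)^(−b') · v( −x/(1−x), xy/((1−x)(1−y)) ) satisfies Appell's system E₂(a, b, b', a, a) in the variables (x,y) on Ω. (First inclusion of Theorem 2.4.) -/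
noncomputable section

open Filter Topology Set Metric

/-- Continuous and separately holomorphic. -/
structure SepHol (U : Set (ℂ × ℂ)) (f : ℂ → ℂ → ℂ) : Prop where
  cont : ∀ x y, (x, y) ∈ U → ContinuousAt (fun p : ℂ × ℂ => f p.1 p.2) (x, y)
  dx : ∀ x y, (x, y) ∈ U → DifferentiableAt ℂ (fun s => f s y) x
  dy : ∀ x y, (x, y) ∈ U → DifferentiableAt ℂ (fun t => f x t) y

lemma SepHol.swap {U : Set (ℂ × ℂ)} {f : ℂ → ℂ → ℂ} (h : SepHol U f) :
    SepHol (Prod.swap ⁻¹' U) (fun x y => f y x) := by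
  refine ⟨fun x y hxy => ?_, fun x y hxy => h.dy y x hxy, fun x y hxy => h.dx y x hxy⟩
  have := h.cont y x hxy
  exact ContinuousAt.comp (f := fun p : ℂ × ℂ => (p.2, p.1)) (x := (x, y)) this (by fun_prop)

lemma exists_bidisc {U : Set (ℂ × ℂ)} (hU : IsOpen U) {x y : ℂ} (h : (x, y) ∈ U) :
    ∃ r > 0, ∀ s ∈ ball x r, ∀ t ∈ ball y r, (s, t) ∈ U := by
  obtain ⟨r, hr, hb⟩ := Metric.isOpen_iff.1 hU _ h
  refine ⟨r, hr, fun s hs t ht => hb ?_⟩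
  rw [← ball_prod_same]
  exact ⟨hs, ht⟩

lemma SepHol.cont_pdx {U : Set (ℂ × ℂ)} (hU : IsOpen U) {f : ℂ → ℂ → ℂ} (h : SepHol U f)
    (x y : ℂ) (hxy : (x, y) ∈ U) :
    ContinuousAt (fun p : ℂ × ℂ => pdx f p.1 p.2) (x, y) := by
  obtain ⟨r, hr, hb⟩ := exists_bidisc hU hxy
  have hloc : TendstoLocallyUniformlyOn (fun (q : ℂ × ℂ) (s : ℂ) => f s q.2)
      (fun s => f s y) (𝓝 (x, y)) (ball x r) := by
    rw [Metric.tendstoLocallyUniformlyOn_iff]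
    intro ε hε s hs
    have hc := h.cont s y (hb s hs y (mem_ball_self hr))
    have h1 := Metric.tendsto_nhds.1 hc (ε / 2) (by positivity)
    rw [nhds_prod_eq, eventually_prod_iff] at h1
    obtain ⟨pa, hpa, pb, hpb, hp⟩ := h1
    refine ⟨{s | pa s}, mem_nhdsWithin_of_mem_nhds hpa, ?_⟩
    have : Tendsto (fun q : ℂ × ℂ => q.2) (𝓝 (x, y)) (𝓝 y) :=
      (continuous_snd.tendsto (x, y))
    filter_upwards [this.eventually hpb] with q hq s' hs'
    have e1 := hp hs' hq
    have e2 := hp hs' hpb.self_of_nhds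
    calc dist (f s' y) (f s' q.2) ≤ dist (f s' y) (f s y) + dist (f s' q.2) (f s y) :=
          dist_triangle_right _ _ _
      _ < ε := by simp only at e1 e2; linarith
  have hdiff : ∀ᶠ q : ℂ × ℂ in 𝓝 (x, y), DifferentiableOn ℂ (fun s => f s q.2) (ball x r) := by
    have : Tendsto (fun q : ℂ × ℂ => q.2) (𝓝 (x, y)) (𝓝 y) :=
      (continuous_snd.tendsto (x, y))
    filter_upwards [this.eventually (ball_mem_nhds y hr)] with q hq s hs
    exact (h.dx s q.2 (hb s hs _ hq)).differentiableWithinAt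
  have hd := hloc.deriv hdiff isOpen_ball
  have hyd : DifferentiableOn ℂ (fun s => f s y) (ball x r) := fun s hs =>
    (h.dx s y (hb s hs _ (mem_ball_self hr))).differentiableWithinAt
  have hyc := (hyd.deriv isOpen_ball).continuousOn
  refine hd.tendsto_comp (x := x) (g := fun q : ℂ × ℂ => q.1) (hyc x (mem_ball_self hr))
    (mem_ball_self hr) ?_
  rw [isOpen_ball.nhdsWithin_eq (mem_ball_self hr)]
  exact continuous_fst.tendsto (x, y)

lemma SepHol.cont_pdy {U : Set (ℂ × ℂ)} (hU : IsOpen U) {f : ℂ → ℂ → ℂ} (h : SepHol U f)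
    (x y : ℂ) (hxy : (x, y) ∈ U) :
    ContinuousAt (fun p : ℂ × ℂ => pdy f p.1 p.2) (x, y) := by
  have := h.swap.cont_pdx (hU.preimage continuous_swap) y x hxy
  exact ContinuousAt.comp (f := fun p : ℂ × ℂ => (p.2, p.1)) (x := (x, y)) this (by fun_prop)

lemma SepHol.hasDerivAt_pdx {U : Set (ℂ × ℂ)} (hU : IsOpen U) {f : ℂ → ℂ → ℂ} (h : SepHol U f)
    (x y : ℂ) (hxy : (x, y) ∈ U) :
    DifferentiableAt ℂ (fun s => pdy f s y) x ∧
    HasDerivAt (fun t => pdx f x t) (pdx (pdy f) x y) y := by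
  obtain ⟨r, hr, hb⟩ := exists_bidisc hU hxy
  have hloc : TendstoLocallyUniformlyOn (fun (t s : ℂ) => (t - y)⁻¹ * (f s t - f s y))
      (fun s => pdy f s y) (𝓝[≠] y) (ball x r) := by
    rw [Metric.tendstoLocallyUniformlyOn_iff]
    intro ε hε s hs
    have hc := h.cont_pdy hU s y (hb s hs y (mem_ball_self hr))
    have h1 := Metric.tendsto_nhds.1 hc (ε / 4) (by positivity)
    rw [nhds_prod_eq, eventually_prod_iff] at h1
    obtain ⟨pa, hpa, pb, hpb, hp⟩ := h1
    obtain ⟨δ, hδ, hpb'⟩ := Metric.eventually_nhds_iff_ball.1 hpb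
    refine ⟨{s | pa s} ∩ ball x r, inter_mem (mem_nhdsWithin_of_mem_nhds hpa)
      self_mem_nhdsWithin, ?_⟩
    have hmin : 0 < min δ r := lt_min hδ hr
    filter_upwards [mem_nhdsWithin_of_mem_nhds (ball_mem_nhds y hmin), self_mem_nhdsWithin]
      with t ht hne s' hs'
    have hty : t - y ≠ 0 := sub_ne_zero.2 hne
    have key := Convex.norm_image_sub_le_of_norm_hasDerivWithin_le (𝕜 := ℂ)
      (f := fun τ => f s' τ - τ * pdy f s' y)
      (f' := fun τ => pdy f s' τ - pdy f s' y) (s := ball y (min δ r)) (C := ε / 2)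
      (x := y) (y := t) ?_ ?_ (convex_ball _ _) (mem_ball_self hmin) ht
    · have e : pdy f s' y - (t - y)⁻¹ * (f s' t - f s' y) =
          - ((t - y)⁻¹ * (f s' t - t * pdy f s' y - (f s' y - y * pdy f s' y))) := by
        field_simp
        ring
      rw [dist_eq_norm, e, norm_neg, norm_mul, norm_inv]
      have hpos : 0 < ‖t - y‖ := norm_pos_iff.2 hty
      calc _ ≤ ‖t - y‖⁻¹ * (ε / 2 * ‖t - y‖) := by gcongr
        _ = ε / 2 := by field_simp
        _ < ε := by linarith
    · intro τ hτ
      have hτ' : τ ∈ ball y r := ball_subset_ball (min_le_right _ _) hτ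
      have d1 : HasDerivAt (fun τ => f s' τ) (pdy f s' τ) τ :=
        (h.dy s' τ (hb s' hs'.2 τ hτ')).hasDerivAt
      have d2 := d1.sub ((hasDerivAt_id τ).mul_const (pdy f s' y))
      simp only [one_mul] at d2
      exact d2.hasDerivWithinAt
    · intro τ hτ
      have hτ' : τ ∈ ball y δ := ball_subset_ball (min_le_left _ _) hτ
      have e1 := hp hs'.1 (hpb' τ hτ')
      have e2 := hp hs'.1 hpb.self_of_nhds
      rw [← dist_eq_norm]
      have := dist_triangle_right (pdy f s' τ) (pdy f s' y) (pdy f s y)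
      simp only at e1 e2
      linarith
  have hdiff : ∀ t ∈ ball y r, DifferentiableOn ℂ (fun s => f s t) (ball x r) :=
    fun t ht s hs => (h.dx s t (hb s hs _ ht)).differentiableWithinAt
  have hev : ∀ᶠ t in 𝓝[≠] y, t ∈ ball y r := mem_nhdsWithin_of_mem_nhds (ball_mem_nhds y hr)
  have hdiff' : ∀ᶠ t in 𝓝[≠] y, DifferentiableOn ℂ
      (fun s => (t - y)⁻¹ * (f s t - f s y)) (ball x r) := by
    filter_upwards [hev] with t ht
    exact ((hdiff t ht).sub (hdiff y (mem_ball_self hr))).const_mul _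
  refine ⟨(hloc.differentiableOn hdiff' isOpen_ball).differentiableAt (ball_mem_nhds x hr), ?_⟩
  have hd := (hloc.deriv hdiff' isOpen_ball).tendsto_at (mem_ball_self hr)
  rw [hasDerivAt_iff_tendsto_slope]
  refine hd.congr' ?_
  filter_upwards [hev] with t ht
  have a1 := h.dx x t (hb x (mem_ball_self hr) t ht)
  have a2 := h.dx x y hxy
  simp only [Function.comp, slope_def_field, pdx]
  rw [deriv_const_mul _ (a1.fun_sub a2), deriv_fun_sub a1 a2]
  ring

lemma SepHol.pdx {U : Set (ℂ × ℂ)} (hU : IsOpen U) {f : ℂ → ℂ → ℂ} (h : SepHol U f) :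
    SepHol U (pdx f) := by
  refine ⟨h.cont_pdx hU, fun x y hxy => ?_, fun x y hxy =>
    (h.hasDerivAt_pdx hU x y hxy).2.differentiableAt⟩
  obtain ⟨r, hr, hb⟩ := exists_bidisc hU hxy
  have hyd : DifferentiableOn ℂ (fun s => f s y) (ball x r) := fun s hs =>
    (h.dx s y (hb s hs _ (mem_ball_self hr))).differentiableWithinAt
  exact (hyd.deriv isOpen_ball).differentiableAt (ball_mem_nhds x hr)

lemma SepHol.pdy {U : Set (ℂ × ℂ)} (hU : IsOpen U) {f : ℂ → ℂ → ℂ} (h : SepHol U f) :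
    SepHol U (pdy f) :=
  (h.swap.pdx (hU.preimage continuous_swap)).swap

lemma SepHol.comm {U : Set (ℂ × ℂ)} (hU : IsOpen U) {f : ℂ → ℂ → ℂ} (h : SepHol U f)
    (x y : ℂ) (hxy : (x, y) ∈ U) : _root_.pdy (_root_.pdx f) x y = _root_.pdx (_root_.pdy f) x y :=
  (h.hasDerivAt_pdx hU x y hxy).2.deriv

lemma SepHol.chain {U : Set (ℂ × ℂ)} (hU : IsOpen U) {f : ℂ → ℂ → ℂ} (h : SepHol U f)
    {α β : ℂ → ℂ} {α' β' τ : ℂ} (hα : HasDerivAt α α' τ) (hβ : HasDerivAt β β' τ)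
    (hm : (α τ, β τ) ∈ U) :
    HasDerivAt (fun τ => f (α τ) (β τ))
      (_root_.pdx f (α τ) (β τ) * α' + _root_.pdy f (α τ) (β τ) * β') τ := by
  have hs : HasStrictFDerivAt (fun p : ℂ × ℂ => f p.1 p.2) _ (α τ, β τ) :=
    hasStrictFDerivAt_uncurry_coprod (𝕜 := ℂ) (u := (α τ, β τ)) (f := f)
      (f₁ := fun x y => ContinuousLinearMap.toSpanSingleton ℂ (_root_.pdx f x y))
      (f₂ := fun x y => ContinuousLinearMap.toSpanSingleton ℂ (_root_.pdy f x y))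
      (by filter_upwards [hU.mem_nhds hm] with v hv
          exact (h.dx v.1 v.2 hv).hasDerivAt.hasFDerivAt)
      (by filter_upwards [hU.mem_nhds hm] with v hv
          exact (h.dy v.1 v.2 hv).hasDerivAt.hasFDerivAt)
      ((ContinuousLinearMap.toSpanSingletonCLE (𝕜 := ℂ) (E := ℂ)).continuous.continuousAt.comp
        (h.cont_pdx hU _ _ hm))
      ((ContinuousLinearMap.toSpanSingletonCLE (𝕜 := ℂ) (E := ℂ)).continuous.continuousAt.comp
        (h.cont_pdy hU _ _ hm))
  have := hs.hasFDerivAt.comp_hasDerivAt τ (hα.prodMk hβ)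
  refine this.congr_deriv ?_
  change α' • _root_.pdx f (α τ) (β τ) + β' • _root_.pdy f (α τ) (β τ) = _
  simp only [smul_eq_mul]
  ring

/-- The gauge transform of the statement. -/
def gTr (b b' : ℂ) (w : ℂ → ℂ → ℂ) : ℂ → ℂ → ℂ := fun x y =>
  (1 - x) ^ (-b) * (1 - y) ^ (-b') * w (-x / (1 - x)) (x * y / ((1 - x) * (1 - y)))

lemma gTr_dx {U : Set (ℂ × ℂ)} (hU : IsOpen U) {f : ℂ → ℂ → ℂ} (h : SepHol U f) (b b' : ℂ)
    {x y : ℂ} (hx : 1 - x ∈ Complex.slitPlane) (hy : 1 - y ∈ Complex.slitPlane)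
    (hm : (-x / (1 - x), x * y / ((1 - x) * (1 - y))) ∈ U) :
    HasDerivAt (fun s => gTr b b' f s y)
      (b * (1 - x)⁻¹ * gTr b b' f x y - ((1 - x)⁻¹) ^ 2 * gTr b b' (pdx f) x y
        + ((1 - x)⁻¹) ^ 2 * (y * (1 - y)⁻¹) * gTr b b' (pdy f) x y) x := by
  have hx0 : 1 - x ≠ 0 := Complex.slitPlane_ne_zero hx
  have hy0 : 1 - y ≠ 0 := Complex.slitPlane_ne_zero hy
  have i1 := (hasDerivAt_id' x).const_sub 1
  have hS : HasDerivAt (fun s : ℂ => -s / (1 - s)) (-((1 - x)⁻¹) ^ 2) x := by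
    refine HasDerivAt.congr_deriv ((hasDerivAt_id' x).fun_neg.fun_div i1 hx0) ?_
    field_simp
    ring
  have hT : HasDerivAt (fun s : ℂ => s * y / ((1 - s) * (1 - y)))
      (((1 - x)⁻¹) ^ 2 * (y * (1 - y)⁻¹)) x := by
    refine HasDerivAt.congr_deriv (((hasDerivAt_id' x).mul_const y).fun_div (i1.mul_const (1 - y))
      (mul_ne_zero hx0 hy0)) ?_
    field_simp
    ring
  have hP := (i1.cpow_const (c := -b) hx).mul_const ((1 - y) ^ (-b'))
  have := hP.fun_mul (h.chain hU hS hT hm)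
  refine this.congr_deriv ?_
  simp only [gTr]
  rw [Complex.cpow_sub _ _ hx0, Complex.cpow_one]
  field_simp
  ring

lemma gTr_dy {U : Set (ℂ × ℂ)} (hU : IsOpen U) {f : ℂ → ℂ → ℂ} (h : SepHol U f) (b b' : ℂ)
    {x y : ℂ} (hx : 1 - x ∈ Complex.slitPlane) (hy : 1 - y ∈ Complex.slitPlane)
    (hm : (-x / (1 - x), x * y / ((1 - x) * (1 - y))) ∈ U) :
    HasDerivAt (fun t => gTr b b' f x t)
      (b' * (1 - y)⁻¹ * gTr b b' f x y
        + x * (1 - x)⁻¹ * ((1 - y)⁻¹) ^ 2 * gTr b b' (pdy f) x y) y := by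
  have hx0 : 1 - x ≠ 0 := Complex.slitPlane_ne_zero hx
  have hy0 : 1 - y ≠ 0 := Complex.slitPlane_ne_zero hy
  have i1 := (hasDerivAt_id' y).const_sub 1
  have hT : HasDerivAt (fun t : ℂ => x * t / ((1 - x) * (1 - t)))
      (x * (1 - x)⁻¹ * ((1 - y)⁻¹) ^ 2) y := by
    refine HasDerivAt.congr_deriv (((hasDerivAt_id' y).const_mul x).fun_div (i1.const_mul (1 - x))
      (mul_ne_zero hx0 hy0)) ?_
    field_simp
    ring
  have hP := (i1.cpow_const (c := -b') hy).const_mul ((1 - x) ^ (-b))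
  have := hP.fun_mul (h.chain hU (hasDerivAt_const y (-x / (1 - x))) hT hm)
  refine this.congr_deriv ?_
  simp only [gTr]
  rw [Complex.cpow_sub _ _ hy0, Complex.cpow_one]
  field_simp
  ring

/-- First inclusion of Theorem 2.4: if `v` solves Appell's system `E₁(b, 0, b', a)` on `U`, then
`z(x,y) = (1−x)^(−b) (1−y)^(−b') · v(−x/(1−x), xy/((1−x)(1−y)))` solves Appell's system
`E₂(a, b, b', a, a)` on `Ω`. -/
theorem stmt2 (a b b' : ℂ) (U : Set (ℂ × ℂ)) (hU : IsOpen U)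
    (v : ℂ → ℂ → ℂ)
    (hv : DifferentiableOn ℂ (fun p : ℂ × ℂ => v p.1 p.2) U)
    (hE1 : ∀ p ∈ U, appellP1 b 0 b' a v p.1 p.2 = 0 ∧
      appellQ1 b 0 b' a v p.1 p.2 = 0 ∧
      appellR1 b 0 b' a v p.1 p.2 = 0)
    (Ω : Set (ℂ × ℂ)) (hΩ : IsOpen Ω)
    (hmem : ∀ p ∈ Ω, (1 - p.1) ∈ Complex.slitPlane ∧ (1 - p.2) ∈ Complex.slitPlane ∧
      (-p.1 / (1 - p.1), p.1 * p.2 / ((1 - p.1) * (1 - p.2))) ∈ U) :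
    ∀ p ∈ Ω,
      appellP2 a b a
        (fun x y => (1 - x) ^ (-b) * (1 - y) ^ (-b') *
          v (-x / (1 - x)) (x * y / ((1 - x) * (1 - y))))
        p.1 p.2 = 0 ∧
      appellQ2 a b' a
        (fun x y => (1 - x) ^ (-b) * (1 - y) ^ (-b') *
          v (-x / (1 - x)) (x * y / ((1 - x) * (1 - y))))
        p.1 p.2 = 0 := by
  have hSv : SepHol U v := by
    refine ⟨fun x y hxy => ?_, fun x y hxy => ?_, fun x y hxy => ?_⟩
    · exact (hv.differentiableAt (hU.mem_nhds hxy)).continuousAt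
    · have := hv.differentiableAt (hU.mem_nhds hxy)
      exact DifferentiableAt.comp (f := fun s : ℂ => (s, y)) x this (by fun_prop)
    · have := hv.differentiableAt (hU.mem_nhds hxy)
      exact DifferentiableAt.comp (f := fun t : ℂ => (x, t)) y this (by fun_prop)
  have hSs := hSv.pdx hU
  have hSt := hSv.pdy hU
  set M : ℂ → ℂ → Prop := fun x y => (1 - x) ∈ Complex.slitPlane ∧ (1 - y) ∈ Complex.slitPlane ∧
      (-x / (1 - x), x * y / ((1 - x) * (1 - y))) ∈ U with hM
  have hMx : ∀ x y, (x, y) ∈ Ω → ∀ᶠ s in 𝓝 x, M s y := fun x y h => by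
    have : Tendsto (fun s : ℂ => (s, y)) (𝓝 x) (𝓝 (x, y)) :=
      (Continuous.prodMk continuous_id continuous_const).tendsto x
    filter_upwards [this.eventually (hΩ.mem_nhds h)] with s hs using hmem _ hs
  have hMy : ∀ x y, (x, y) ∈ Ω → ∀ᶠ t in 𝓝 y, M x t := fun x y h => by
    have : Tendsto (fun t : ℂ => (x, t)) (𝓝 y) (𝓝 (x, y)) :=
      (Continuous.prodMk continuous_const continuous_id).tendsto y
    filter_upwards [this.eventually (hΩ.mem_nhds h)] with s hs using hmem _ hs
  rintro ⟨x, y⟩ hp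
  have hxy : M x y := hmem _ hp
  have hx0 : 1 - x ≠ 0 := Complex.slitPlane_ne_zero hxy.1
  have hy0 : 1 - y ≠ 0 := Complex.slitPlane_ne_zero hxy.2.1
  obtain ⟨e1, e2, e3⟩ := hE1 _ hxy.2.2
  have hcm := hSv.comm hU _ _ hxy.2.2
  change appellP2 a b a (gTr b b' v) x y = 0 ∧ appellQ2 a b' a (gTr b b' v) x y = 0
  -- first derivatives
  have Zx : ∀ x y, M x y → pdx (gTr b b' v) x y = _ := fun x y h =>
    (gTr_dx hU hSv b b' h.1 h.2.1 h.2.2).deriv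
  have Zy : ∀ x y, M x y → pdy (gTr b b' v) x y = _ := fun x y h =>
    (gTr_dy hU hSv b b' h.1 h.2.1 h.2.2).deriv
  have vx := gTr_dx hU hSv b b' hxy.1 hxy.2.1 hxy.2.2
  have vy := gTr_dy hU hSv b b' hxy.1 hxy.2.1 hxy.2.2
  have sx := gTr_dx hU hSs b b' hxy.1 hxy.2.1 hxy.2.2
  have sy := gTr_dy hU hSs b b' hxy.1 hxy.2.1 hxy.2.2
  have tx := gTr_dx hU hSt b b' hxy.1 hxy.2.1 hxy.2.2
  have ty := gTr_dy hU hSt b b' hxy.1 hxy.2.1 hxy.2.2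
  have cxi : HasDerivAt (fun s : ℂ => (1 - s)⁻¹) (((1 - x)⁻¹) ^ 2) x := by
    have := ((hasDerivAt_id x).const_sub 1).inv hx0
    refine this.congr_deriv ?_
    simp
  have cyi : HasDerivAt (fun s : ℂ => (1 - s)⁻¹) (((1 - y)⁻¹) ^ 2) y := by
    have := ((hasDerivAt_id y).const_sub 1).inv hy0
    refine this.congr_deriv ?_
    simp
  have ix := hasDerivAt_id' x
  have iy := hasDerivAt_id' y
  -- second derivatives
  have xx : ∀ k : ℂ, pdx (fun x y => k * gTr b b' v x y + Dx (gTr b b' v) x y) x y = _ :=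
    fun k => (((vx.const_mul k).add (ix.mul (((cxi.const_mul b).mul vx).sub
      ((cxi.pow 2).mul sx) |>.add
      ((((cxi.pow 2).mul_const (y * (1 - y)⁻¹))).mul tx)))).congr_of_eventuallyEq (by
      filter_upwards [hMx x y hp] with s hs
      simp only [Dx, Zx s y hs]; rfl)).deriv
  have xy : ∀ k : ℂ, pdy (fun x y => k * gTr b b' v x y + Dx (gTr b b' v) x y) x y = _ :=
    fun k => (((vy.const_mul k).add ((((vy.const_mul (b * (1 - x)⁻¹))).sub
      (sy.const_mul (((1 - x)⁻¹) ^ 2)) |>.add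
      (((iy.mul cyi).const_mul (((1 - x)⁻¹) ^ 2)).mul ty)).const_mul x)).congr_of_eventuallyEq (by
      filter_upwards [hMy x y hp] with s hs
      simp only [Dx, Zx x s hs]; rfl)).deriv
  have yy : ∀ k : ℂ, pdy (fun x y => k * gTr b b' v x y + Dy (gTr b b' v) x y) x y = _ :=
    fun k => (((vy.const_mul k).add (iy.mul (((cyi.const_mul b').mul vy).add
      (((cyi.pow 2).const_mul (x * (1 - x)⁻¹)).mul ty)))).congr_of_eventuallyEq (by
      filter_upwards [hMy x y hp] with s hs
      simp only [Dy, Zy x s hs]; rfl)).deriv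
  have yx : ∀ k : ℂ, pdx (fun x y => k * gTr b b' v x y + Dy (gTr b b' v) x y) x y = _ :=
    fun k => (((vx.const_mul k).add (((vx.const_mul (b' * (1 - y)⁻¹)).add
      (((ix.mul cxi).mul_const (((1 - y)⁻¹) ^ 2)).mul tx)).const_mul y)).congr_of_eventuallyEq (by
      filter_upwards [hMx x y hp] with s hs
      simp only [Dy, Zy s y hs]; rfl)).deriv
  have zx := Zx x y hxy
  have zy := Zy x y hxy
  simp only [appellP1, appellQ1, appellR1] at e1 e2 e3
  have hc : gTr b b' (pdy (pdx v)) x y = gTr b b' (pdx (pdy v)) x y := by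
    simp only [gTr, hcm]
  set g : ℂ := (1 - x) ^ (-b) * (1 - y) ^ (-b') with hg
  set S : ℂ := -x / (1 - x) with hS
  set T : ℂ := x * y / ((1 - x) * (1 - y)) with hT
  have hG : ∀ w, gTr b b' w x y = g * w S T := fun w => rfl
  have hX : x * (1 - x)⁻¹ = - S := by rw [hS]; ring
  clear_value g S T
  constructor
  · simp only [appellP2]
    rw [Dx, Dx, Dx, Dy, xx, xx, xy, zx]
    simp only [Pi.pow_apply, Pi.mul_apply, Pi.add_apply, Pi.sub_apply]
    try simp only [hc]
    simp only [hG]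
    generalize v S T = w at *
    generalize pdx v S T = ws at *
    generalize pdy v S T = wt at *
    generalize pdx (pdx v) S T = wss at *
    generalize pdx (pdy v) S T = wst at *
    generalize pdy (pdy v) S T = wtt at *
    clear * - e1 e2 e3 hS hT hx0 hy0
    linear_combination (norm := skip) g * S * e1 + g * T * e2
    simp only [hS, hT, Nat.reduceSub, pow_one, Nat.cast_ofNat]
    field_simp
    ring
  · simp only [appellQ2]
    rw [Dy, Dy, Dx, Dy, yy, yy, yx, zy]
    simp only [Pi.pow_apply, Pi.mul_apply, Pi.add_apply, Pi.sub_apply]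
    try simp only [hc]
    simp only [hG]
    generalize v S T = w at *
    generalize pdx v S T = ws at *
    generalize pdy v S T = wt at *
    generalize pdx (pdx v) S T = wss at *
    generalize pdx (pdy v) S T = wst at *
    generalize pdy (pdy v) S T = wtt at *
    clear * - e1 e2 e3 hS hT hx0 hy0
    linear_combination (norm := skip) g * T * e2 - g * T * e3
    simp only [hS, hT, Nat.reduceSub, pow_one, Nat.cast_ofNat]
    field_simp
    ring
end
end

section
/- Let a, b, c ∈ ℂ and define, for real numbers 0 < s < 1 < x, the function Φ(x,s) = s^(b−c) (1−s)^(c−a−1) (x−s)^(−b), where for a positive real r and e ∈ ℂ, r^e = exp(e · log r). Then for all (x,s) with 0 < s < 1 < x, x·( x(1−x)·∂²Φ/∂x² + (c−(a+b+1)x)·∂Φ/∂x − ab·Φ ) = b·x·∂/∂s( (s(1−s)/(x−s))·Φ ). (Lemma 2.1: P(a,b,c;x)Φ is an exact derivative in s.) -/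
noncomputable section

/-- The power `r^e = exp(e·log r)` of a positive real `r` with complex exponent `e`. -/
def cpowR (r : ℝ) (e : ℂ) : ℂ := Complex.exp (e * (Real.log r : ℂ))

/-- The function `Φ(x,s) = s^(b−c) (1−s)^(c−a−1) (x−s)^(−b)` for `0 < s < 1 < x`. -/
def PhiFn (a b c : ℂ) (x s : ℝ) : ℂ :=
  cpowR s (b - c) * cpowR (1 - s) (c - a - 1) * cpowR (x - s) (-b)

lemma cpowR_hasDerivAt (f : ℝ → ℝ) (f' t : ℝ) (e : ℂ) (hf : HasDerivAt f f' t) (h : 0 < f t) :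
    HasDerivAt (fun t => cpowR (f t) e) (cpowR (f t) e * (e * ((f' : ℂ) / (f t : ℂ)))) t := by
  have h1 := (hf.log h.ne').ofReal_comp
  have h2 := (h1.const_mul e).cexp
  simpa [cpowR] using h2

lemma Phi_dx (a b c : ℂ) (x s : ℝ) (h : s < x) :
    HasDerivAt (fun x' : ℝ => PhiFn a b c x' s) (-b / ((x : ℂ) - s) * PhiFn a b c x s) x := by
  have h1 := cpowR_hasDerivAt (fun x => x - s) 1 x (-b) ((hasDerivAt_id x).sub_const s)
    (by simpa using h)
  have h2 := h1.const_mul (cpowR s (b - c) * cpowR (1 - s) (c - a - 1))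
  refine h2.congr_deriv ?_
  simp only [PhiFn]
  push_cast
  ring

lemma Phi_ds (a b c : ℂ) (x s : ℝ) (h0 : 0 < s) (h1 : s < 1) (h : s < x) :
    HasDerivAt (fun s' : ℝ => PhiFn a b c x s')
      (((b - c) / s - (c - a - 1) / (1 - (s : ℂ)) + b / ((x : ℂ) - s)) * PhiFn a b c x s) s := by
  have k1 := cpowR_hasDerivAt (fun s => s) 1 s (b - c) (hasDerivAt_id s) h0
  have k2 := cpowR_hasDerivAt (fun s => 1 - s) (-1) s (c - a - 1)
    ((hasDerivAt_id s).const_sub 1) (by simpa using h1)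
  have k3 := cpowR_hasDerivAt (fun s => x - s) (-1) s (-b)
    ((hasDerivAt_id s).const_sub x) (by simpa using h)
  refine ((k1.mul k2).mul k3).congr_deriv ?_
  simp only [PhiFn, Pi.mul_apply]
  push_cast
  ring

/-- Lemma 2.1: `P(a,b,c;x)Φ = b x ∂/∂s ( s(1−s)/(x−s) · Φ )` for `0 < s < 1 < x`. -/
theorem stmt7 (a b c : ℂ) :
    ∀ x s : ℝ, 0 < s → s < 1 → 1 < x →
      (x : ℂ) *
        ((x : ℂ) * (1 - (x : ℂ)) *
            deriv (fun x' : ℝ => deriv (fun x'' : ℝ => PhiFn a b c x'' s) x') x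
          + (c - (a + b + 1) * (x : ℂ)) * deriv (fun x' : ℝ => PhiFn a b c x' s) x
          - a * b * PhiFn a b c x s) =
      b * (x : ℂ) *
        deriv (fun s' : ℝ =>
          ((s' : ℂ) * (1 - (s' : ℂ)) / ((x : ℂ) - (s' : ℂ))) * PhiFn a b c x s') s := by
  intro x s h0 h1 hx
  have hsx : s < x := h1.trans hx
  have hu : (x : ℂ) - s ≠ 0 := by
    exact_mod_cast (sub_pos.2 hsx).ne'
  have hs : (s : ℂ) ≠ 0 := by exact_mod_cast h0.ne'
  have hs1 : (1 : ℂ) - s ≠ 0 := by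
    exact_mod_cast (sub_pos.2 h1).ne'
  have e1 : (fun x' : ℝ => deriv (fun x'' : ℝ => PhiFn a b c x'' s) x') =ᶠ[nhds x]
      fun x' : ℝ => -b / ((x' : ℂ) - s) * PhiFn a b c x' s := by
    filter_upwards [lt_mem_nhds hsx] with y hy
    exact (Phi_dx a b c y s hy).deriv
  have i1 : HasDerivAt (fun y : ℝ => (y : ℂ)) 1 x := by
    simpa using (hasDerivAt_id x).ofReal_comp
  have i2 : HasDerivAt (fun y : ℝ => (y : ℂ)) 1 s := by
    simpa using (hasDerivAt_id s).ofReal_comp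
  have d2 := ((hasDerivAt_const x (-b)).fun_div (i1.sub_const (s : ℂ)) hu).fun_mul
    (Phi_dx a b c x s hsx)
  have d3 := ((i2.fun_mul (i2.const_sub 1)).fun_div (i2.const_sub (x : ℂ)) hu).fun_mul
    (Phi_ds a b c x s h0 h1 hsx)
  rw [e1.deriv_eq, d2.deriv, (Phi_dx a b c x s hsx).deriv, d3.deriv]
  generalize PhiFn a b c x s = F
  field_simp
  ring
end
end

section
/- Let a, b, c ∈ ℂ with Re(b−c) > −1. For (s,t) in the domain D = {(s,t) ∈ ℝ² : 0 < s < 1 < t}, define u(s,t) = ∫₀^s σ^(b−c) (1−σ)^(c−a−1) (t−σ)^(−b) dσ, where for a positive real r and e ∈ ℂ, r^e = exp(e·log r). Then u satisfies the system E₁(a, 0, b, c) in the variables (s,t) on D; that is, s(1−s)·u_ss + t(1−s)·u_st + (c−(a+1)s)·u_s = 0, t(1−t)·u_tt + s(1−t)·u_st + (c−(a+b+1)t)·u_t − b s·u_s − ab·u = 0, and (s−t)·u_st − b·u_s = 0 on D. (Lemma 2.2: the indefinite integral of Φ solves E₁(a,0,b,c).) -/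
noncomputable section

/-- The indefinite integral `u(s,t) = ∫₀^s σ^(b−c) (1−σ)^(c−a−1) (t−σ)^(−b) dσ`. -/
def uInt (a b c : ℂ) (s t : ℝ) : ℂ :=
  ∫ σ in (0:ℝ)..s, cpowR σ (b - c) * cpowR (1 - σ) (c - a - 1) * cpowR (t - σ) (-b)


open MeasureTheory Set Filter Topology

theorem cpowR_add_one {r : ℝ} (hr : 0 < r) (e : ℂ) : cpowR r (e + 1) = cpowR r e * r := by
  unfold cpowR
  rw [add_mul, Complex.exp_add, one_mul, ← Complex.ofReal_exp, Real.exp_log hr]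

theorem cpowR_eq {r : ℝ} (hr : 0 < r) (e : ℂ) : cpowR r e = (r : ℂ) ^ e := by
  unfold cpowR
  rw [Complex.cpow_def_of_ne_zero (by exact_mod_cast hr.ne'), Complex.ofReal_log hr.le, mul_comm]

theorem cpowR_sub_one {r : ℝ} (hr : 0 < r) (e : ℂ) : cpowR r (e - 1) = cpowR r e / r := by
  have h := cpowR_add_one hr (e - 1)
  rw [sub_add_cancel] at h
  rw [h, mul_div_cancel_right₀]
  exact_mod_cast hr.ne'

theorem cpowR_hasDerivAt_s8 {r : ℝ} (hr : 0 < r) (e : ℂ) :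
    HasDerivAt (fun x : ℝ => cpowR x e) (e * cpowR r (e - 1)) r := by
  have h1 : HasDerivAt (fun x : ℝ => ((Real.log x : ℝ) : ℂ)) ((r⁻¹ : ℝ) : ℂ) r :=
    (Real.hasDerivAt_log hr.ne').ofReal_comp
  have h2 := (h1.const_mul e).cexp
  rw [cpowR_sub_one hr]
  refine HasDerivAt.congr_deriv (f := fun x : ℝ => cpowR x e) h2 ?_
  change cpowR r e * _ = _
  push_cast
  ring

theorem cpowR_continuousAt {r : ℝ} (hr : 0 < r) (e : ℂ) :
    ContinuousAt (fun x : ℝ => cpowR x e) r := (cpowR_hasDerivAt_s8 hr e).continuousAt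

/-- integrand -/
def Fn (p q e : ℂ) (t σ : ℝ) : ℂ := cpowR σ p * cpowR (1 - σ) q * cpowR (t - σ) e

theorem cpowR_sub_hasDerivAt {t σ : ℝ} (h : σ < t) (e : ℂ) :
    HasDerivAt (fun x : ℝ => cpowR (t - x) e) (-(e * cpowR (t - σ) (e - 1))) σ := by
  have h1 : HasDerivAt (fun x : ℝ => t - x) (-1) σ := by
    simpa using (hasDerivAt_id σ).const_sub t
  have := (cpowR_hasDerivAt_s8 (sub_pos.2 h) e).scomp σ h1
  simpa [Function.comp_def] using this

theorem cpowR_sub_hasDerivAt' {t σ : ℝ} (h : σ < t) (e : ℂ) :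
    HasDerivAt (fun x : ℝ => cpowR (x - σ) e) (e * cpowR (t - σ) (e - 1)) t := by
  have h1 : HasDerivAt (fun x : ℝ => x - σ) 1 t := (hasDerivAt_id t).sub_const σ
  have := (cpowR_hasDerivAt_s8 (sub_pos.2 h) e).scomp t h1
  simpa [Function.comp_def] using this

theorem cpowR_intble {p : ℂ} (hp : -1 < p.re) {s : ℝ} (hs : 0 < s) :
    IntervalIntegrable (fun σ : ℝ => cpowR σ p) volume 0 s := by
  refine (intervalIntegral.intervalIntegrable_cpow' (a := 0) (b := s) hp).congr ?_
  intro x hx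
  rw [uIoc_of_le hs.le] at hx
  exact (cpowR_eq hx.1 p).symm

theorem w_intble {p : ℂ} (q : ℂ) (hp : -1 < p.re) {s : ℝ} (hs : 0 < s) (hs1 : s < 1) :
    IntervalIntegrable (fun σ : ℝ => cpowR σ p * cpowR (1 - σ) q) volume 0 s := by
  refine (cpowR_intble hp hs).mul_continuousOn ?_
  intro x hx
  rw [uIcc_of_le hs.le] at hx
  exact (cpowR_sub_hasDerivAt (by linarith [hx.2]) q).continuousAt.continuousWithinAt

theorem Fn_intble {p : ℂ} (q e : ℂ) (hp : -1 < p.re) {s t : ℝ} (hs : 0 < s) (hs1 : s < 1)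
    (ht : 1 < t) : IntervalIntegrable (Fn p q e t) volume 0 s := by
  refine (w_intble q hp hs hs1).mul_continuousOn ?_
  intro x hx
  rw [uIcc_of_le hs.le] at hx
  exact (cpowR_sub_hasDerivAt (by linarith [hx.2]) e).continuousAt.continuousWithinAt

theorem Fn_hasDerivAt (p q e : ℂ) {s t : ℝ} (hs : 0 < s) (hs1 : s < 1) (ht : 1 < t) :
    HasDerivAt (Fn p q e t)
      (Fn p q e t s * (p / s - q / (1 - s) - e / (t - s))) s := by
  have h := ((cpowR_hasDerivAt_s8 hs p).mul (cpowR_sub_hasDerivAt hs1 q)).mul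
    (cpowR_sub_hasDerivAt (hs1.trans ht) e)
  refine HasDerivAt.congr_deriv (f := Fn p q e t) h ?_
  rw [cpowR_sub_one hs, cpowR_sub_one (sub_pos.2 hs1), cpowR_sub_one (sub_pos.2 (hs1.trans ht))]
  unfold Fn
  push_cast
  simp only [Pi.mul_apply]
  ring

theorem Fn_int_s {p : ℂ} (q e : ℂ) (hp : -1 < p.re) {s t : ℝ} (hs : 0 < s) (hs1 : s < 1)
    (ht : 1 < t) : HasDerivAt (fun s' : ℝ => ∫ σ in (0:ℝ)..s', Fn p q e t σ) (Fn p q e t s) s := by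
  refine intervalIntegral.integral_hasDerivAt_right (Fn_intble q e hp hs hs1 ht) ?_
    (Fn_hasDerivAt p q e hs hs1 ht).continuousAt
  exact ContinuousAt.stronglyMeasurableAtFilter (s := Ioo 0 1) isOpen_Ioo
    (fun x hx => (Fn_hasDerivAt p q e hx.1 hx.2 ht).continuousAt) s ⟨hs, hs1⟩

theorem Fn_int_t {p : ℂ} (q e : ℂ) (hp : -1 < p.re) {s t : ℝ} (hs : 0 < s) (hs1 : s < 1)
    (ht : 1 < t) : HasDerivAt (fun t' : ℝ => ∫ σ in (0:ℝ)..s, Fn p q e t' σ)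
      (e * ∫ σ in (0:ℝ)..s, Fn p q (e - 1) t σ) t := by
  have hK : ContinuousOn (fun r : ℝ => e * cpowR r (e - 1)) (Icc (1 - s) (t + 1)) := by
    intro r hr
    exact ((cpowR_continuousAt (by linarith [hr.1]) (e - 1)).const_mul e).continuousWithinAt
  obtain ⟨C, hC⟩ := isCompact_Icc.exists_bound_of_continuousOn hK
  rw [← intervalIntegral.integral_const_mul]
  refine (intervalIntegral.hasDerivAt_integral_of_dominated_loc_of_deriv_le
    (F := fun t' σ => Fn p q e t' σ) (F' := fun t' σ => e * Fn p q (e - 1) t' σ)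
    (bound := fun σ => ‖cpowR σ p * cpowR (1 - σ) q‖ * C)
    (s := Ioo 1 (t + 1)) (Ioo_mem_nhds ht (by linarith)) ?_ (Fn_intble q e hp hs hs1 ht)
    ?_ ?_ ?_ ?_).2
  · filter_upwards [lt_mem_nhds ht] with x hx
    exact (intervalIntegrable_iff.1 (Fn_intble q e hp hs hs1 hx)).aestronglyMeasurable
  · exact (intervalIntegrable_iff.1 ((Fn_intble q (e - 1) hp hs hs1 ht).const_mul e)).aestronglyMeasurable
  · refine Eventually.of_forall fun σ hσ x hx => ?_
    rw [uIoc_of_le hs.le] at hσ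
    have : e * Fn p q (e - 1) x σ
        = (cpowR σ p * cpowR (1 - σ) q) * (e * cpowR (x - σ) (e - 1)) := by
      unfold Fn; ring
    rw [this, norm_mul]
    exact mul_le_mul_of_nonneg_left
      (hC _ ⟨by linarith [hσ.2, hx.1], by linarith [hσ.1, hx.2]⟩) (norm_nonneg _)
  · exact (w_intble q hp hs hs1).norm.mul_const C
  · refine Eventually.of_forall fun σ hσ x hx => ?_
    rw [uIoc_of_le hs.le] at hσ
    have := (cpowR_sub_hasDerivAt' (t := x) (σ := σ) (by linarith [hσ.2, hx.1]) e).const_mul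
      (cpowR σ p * cpowR (1 - σ) q)
    refine HasDerivAt.congr_deriv (f := fun x => Fn p q e x σ) this ?_
    unfold Fn; ring

theorem parts (a b c : ℂ) (hbc : -1 < (b - c).re) {s t : ℝ} (hs : 0 < s) (hs1 : s < 1)
    (ht : 1 < t) :
    (t * (1 - t) * (b + 1)) * (∫ σ in (0:ℝ)..s, Fn (b - c) (c - a - 1) (-b - 1 - 1) t σ)
      - (c - (a + b + 1) * t) * (∫ σ in (0:ℝ)..s, Fn (b - c) (c - a - 1) (-b - 1) t σ)
      - a * (∫ σ in (0:ℝ)..s, Fn (b - c) (c - a - 1) (-b) t σ)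
    = Fn (b - c) (c - a - 1) (-b) t s * (s * (1 - s) / (t - s)) := by
  have i2 := (Fn_intble (c - a - 1) (-b - 1 - 1) hbc hs hs1 ht).const_mul (t * (1 - t) * (b + 1))
  have i1 := (Fn_intble (c - a - 1) (-b - 1) hbc hs hs1 ht).const_mul (c - (a + b + 1) * t)
  have i0 := (Fn_intble (c - a - 1) (-b) hbc hs hs1 ht).const_mul a
  rw [← intervalIntegral.integral_const_mul, ← intervalIntegral.integral_const_mul,
    ← intervalIntegral.integral_const_mul, ← intervalIntegral.integral_sub i2 i1,
    ← intervalIntegral.integral_sub (i2.sub i1) i0]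
  have hre : 0 < (b - c + 1).re := by
    simp only [Complex.add_re, Complex.one_re]; linarith
  have key := intervalIntegral.integral_eq_sub_of_hasDerivAt_of_le
    (f := fun σ : ℝ => (σ : ℂ) ^ (b - c + 1) * cpowR (1 - σ) (c - a - 1 + 1)
      * cpowR (t - σ) (-b - 1)) hs.le ?_ ?_ ((i2.sub i1).sub i0)
  · refine key.trans ?_
    have h0 : (0 : ℂ) ^ (b - c + 1) = 0 := Complex.zero_cpow (by
      intro h; rw [h] at hre; simp at hre)
    simp only [Complex.ofReal_zero, h0, zero_mul, sub_zero]
    rw [← cpowR_eq hs, cpowR_add_one hs, cpowR_add_one (sub_pos.2 hs1),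
      cpowR_sub_one (sub_pos.2 (hs1.trans ht))]
    unfold Fn
    push_cast
    ring
  · intro x hx
    refine ContinuousAt.continuousWithinAt ?_
    refine ((Complex.continuousAt_ofReal_cpow_const x _ (Or.inl hre)).mul ?_).mul ?_
    · exact (cpowR_sub_hasDerivAt (by linarith [hx.2]) _).continuousAt
    · exact (cpowR_sub_hasDerivAt (by linarith [hx.2]) _).continuousAt
  · intro x hx
    have hx1 : x < 1 := hx.2.trans hs1
    have hxt : x < t := hx1.trans ht
    have h := Fn_hasDerivAt (b - c + 1) (c - a - 1 + 1) (-b - 1) hx.1 hx1 ht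
    have hev : (fun σ : ℝ => (σ : ℂ) ^ (b - c + 1) * cpowR (1 - σ) (c - a - 1 + 1)
        * cpowR (t - σ) (-b - 1)) =ᶠ[𝓝 x] Fn (b - c + 1) (c - a - 1 + 1) (-b - 1) t := by
      filter_upwards [lt_mem_nhds hx.1] with y hy
      unfold Fn
      rw [cpowR_eq hy]
    refine (h.congr_of_eventuallyEq hev).congr_deriv ?_
    have e1 : (x : ℂ) ≠ 0 := by exact_mod_cast hx.1.ne'
    have e2 : (1 - x : ℂ) ≠ 0 := by exact_mod_cast (sub_pos.2 hx1).ne'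
    have e3 : (t - x : ℂ) ≠ 0 := by exact_mod_cast (sub_pos.2 hxt).ne'
    unfold Fn
    simp only [cpowR_add_one hx.1, cpowR_add_one (sub_pos.2 hx1), cpowR_sub_one (sub_pos.2 hxt)]
    push_cast
    field_simp
    ring

/-- Lemma 2.2: the indefinite integral `u(s,t) = ∫₀^s σ^(b−c)(1−σ)^(c−a−1)(t−σ)^(−b) dσ`
solves Appell's system `E₁(a, 0, b, c)` in the variables `(s,t)` on `{0 < s < 1 < t}`,
provided `Re(b−c) > −1`. -/
theorem stmt8 (a b c : ℂ) (hbc : -1 < (b - c).re) :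
    ∀ s t : ℝ, 0 < s → s < 1 → 1 < t →
      ((s : ℂ) * (1 - (s : ℂ)) *
          deriv (fun s' : ℝ => deriv (fun s'' : ℝ => uInt a b c s'' t) s') s
        + (t : ℂ) * (1 - (s : ℂ)) *
          deriv (fun s' : ℝ => deriv (fun t' : ℝ => uInt a b c s' t') t) s
        + (c - (a + 1) * (s : ℂ)) * deriv (fun s' : ℝ => uInt a b c s' t) s = 0) ∧
      ((t : ℂ) * (1 - (t : ℂ)) *
          deriv (fun t' : ℝ => deriv (fun t'' : ℝ => uInt a b c s t'') t') t
        + (s : ℂ) * (1 - (t : ℂ)) *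
          deriv (fun s' : ℝ => deriv (fun t' : ℝ => uInt a b c s' t') t) s
        + (c - (a + b + 1) * (t : ℂ)) * deriv (fun t' : ℝ => uInt a b c s t') t
        - b * (s : ℂ) * deriv (fun s' : ℝ => uInt a b c s' t) s
        - a * b * uInt a b c s t = 0) ∧
      (((s : ℂ) - (t : ℂ)) *
          deriv (fun s' : ℝ => deriv (fun t' : ℝ => uInt a b c s' t') t) s
        - b * deriv (fun s' : ℝ => uInt a b c s' t) s = 0) := by
  intro s t hs hs1 ht
  have hu : ∀ s t, uInt a b c s t = ∫ σ in (0:ℝ)..s, Fn (b - c) (c - a - 1) (-b) t σ :=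
    fun _ _ => rfl
  simp only [hu]
  have ds : ∀ s', 0 < s' → s' < 1 →
      deriv (fun s'' : ℝ => ∫ σ in (0:ℝ)..s'', Fn (b - c) (c - a - 1) (-b) t σ) s'
        = Fn (b - c) (c - a - 1) (-b) t s' :=
    fun s' h h1 => (Fn_int_s _ _ hbc h h1 ht).deriv
  have dt : ∀ s' t', 0 < s' → s' < 1 → 1 < t' →
      deriv (fun t'' : ℝ => ∫ σ in (0:ℝ)..s', Fn (b - c) (c - a - 1) (-b) t'' σ) t'
        = -b * ∫ σ in (0:ℝ)..s', Fn (b - c) (c - a - 1) (-b - 1) t' σ :=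
    fun s' t' h h1 h2 => (Fn_int_t _ _ hbc h h1 h2).deriv
  have evs : ∀ᶠ s' in 𝓝 s, 0 < s' ∧ s' < 1 := Ioo_mem_nhds hs hs1
  have dss : deriv (fun s' : ℝ => deriv (fun s'' : ℝ =>
      ∫ σ in (0:ℝ)..s'', Fn (b - c) (c - a - 1) (-b) t σ) s') s
      = Fn (b - c) (c - a - 1) (-b) t s * ((b - c) / s - (c - a - 1) / (1 - s) - -b / (t - s)) := by
    rw [EventuallyEq.deriv_eq (evs.mono fun s' h => ds s' h.1 h.2)]
    exact (Fn_hasDerivAt _ _ _ hs hs1 ht).deriv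
  have dst : deriv (fun s' : ℝ => deriv (fun t' : ℝ =>
      ∫ σ in (0:ℝ)..s', Fn (b - c) (c - a - 1) (-b) t' σ) t) s = -b * Fn (b - c) (c - a - 1) (-b - 1) t s := by
    rw [EventuallyEq.deriv_eq (evs.mono fun s' h => dt s' t h.1 h.2 ht)]
    exact ((Fn_int_s _ _ hbc hs hs1 ht).const_mul _).deriv
  have dtt : deriv (fun t' : ℝ => deriv (fun t'' : ℝ =>
      ∫ σ in (0:ℝ)..s, Fn (b - c) (c - a - 1) (-b) t'' σ) t') t
      = -b * ((-b - 1) * ∫ σ in (0:ℝ)..s, Fn (b - c) (c - a - 1) (-b - 1 - 1) t σ) := by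
    rw [EventuallyEq.deriv_eq ((lt_mem_nhds ht).mono fun t' h => dt s t' hs hs1 h)]
    exact ((Fn_int_t _ _ hbc hs hs1 ht).const_mul _).deriv
  rw [dss, dst, dtt, ds s hs hs1, dt s t hs hs1 ht]
  have hp := parts a b c hbc hs hs1 ht
  have hF : Fn (b - c) (c - a - 1) (-b - 1) t s = Fn (b - c) (c - a - 1) (-b) t s / (t - s) := by
    unfold Fn
    rw [cpowR_sub_one (sub_pos.2 (hs1.trans ht))]
    push_cast
    ring
  rw [hF]
  have e1 : (s : ℂ) ≠ 0 := by exact_mod_cast hs.ne'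
  have e2 : (1 - s : ℂ) ≠ 0 := by exact_mod_cast (sub_pos.2 hs1).ne'
  have e3 : (t - s : ℂ) ≠ 0 := by exact_mod_cast (sub_pos.2 (hs1.trans ht)).ne'
  refine ⟨?_, ?_, ?_⟩
  · field_simp
    ring
  · have hx : (s : ℂ) * (1 - t) * (-b * (Fn (b - c) (c - a - 1) (-b) t s / (t - s)))
        - b * s * Fn (b - c) (c - a - 1) (-b) t s
        = - b * (Fn (b - c) (c - a - 1) (-b) t s * (s * (1 - s) / (t - s))) := by
      field_simp
      ring
    linear_combination b * hp + hx
  · field_simp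
    ring
end
end

section
/- Let μ₁, μ₂, μ₃, μ₄, μ₅ ∈ ℂ with μ_i ≠ 1 for i = 1,…,5. Write μ_{ij⋯} for the product μ_i μ_j ⋯. Let H be the 4×4 complex matrix with rows: row 1 = ( (μ₁₂−1)(μ₃₄−1)/((μ₁−1)(μ₂−1)(μ₃−1)(μ₄−1)), 1/((μ₂−1)(μ₄−1)), −μ₁(μ₃₄−1)(μ₁₂₅−1)/((μ₁−1)(μ₃−1)(μ₄−1)), −μ₃(μ₁₂−1)(μ₃₄₅−1)/((μ₁−1)(μ₂−1)(μ₃−1)) ); row 2 = ( μ₂₄/((μ₂−1)(μ₄−1)), (μ₂₄₅−1)/((μ₂−1)(μ₄−1)(μ₅−1)), 0, 0 ); row 3 = ( −(μ₃₄−1)/((μ₁−1)(μ₃−1)(μ₄−1)), 0, μ₁(μ₃₄−1)(μ₂₅−1)/((μ₁−1)(μ₃−1)(μ₄−1)), μ₃(μ₃₄₅−1)/((μ₁−1)(μ₃−1)) ); row 4 = ( −(μ₁₂−1)/((μ₁−1)(μ₂−1)(μ₃−1)), 0, μ₁(μ₁₂₅−1)/((μ₁−1)(μ₃−1)), μ₃(μ₁₂−1)(μ₄₅−1)/((μ₁−1)(μ₂−1)(μ₃−1))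 ). Then det H = μ₁μ₂μ₃μ₄(μ₅−1)(μ₁μ₂μ₃μ₄μ₅−1) / ( (μ₁−1)²(μ₂−1)²(μ₃−1)²(μ₄−1)² ). In particular, if moreover μ_i ≠ 0 for i = 1,…,4 and μ₁μ₂μ₃μ₄μ₅ ≠ 1, then H is invertible. (Proposition 3.3: the intersection matrix H^μ and its determinant.) -/
noncomputable section

/-- The intersection matrix `H^μ` of Proposition 3.3. -/
def Hmu (m1 m2 m3 m4 m5 : ℂ) : Matrix (Fin 4) (Fin 4) ℂ :=
  !![(m1 * m2 - 1) * (m3 * m4 - 1) / ((m1 - 1) * (m2 - 1) * (m3 - 1) * (m4 - 1)),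
      1 / ((m2 - 1) * (m4 - 1)),
      -(m1 * (m3 * m4 - 1) * (m1 * m2 * m5 - 1)) / ((m1 - 1) * (m3 - 1) * (m4 - 1)),
      -(m3 * (m1 * m2 - 1) * (m3 * m4 * m5 - 1)) / ((m1 - 1) * (m2 - 1) * (m3 - 1));
    m2 * m4 / ((m2 - 1) * (m4 - 1)),
      (m2 * m4 * m5 - 1) / ((m2 - 1) * (m4 - 1) * (m5 - 1)),
      0, 0;
    -((m3 * m4 - 1) / ((m1 - 1) * (m3 - 1) * (m4 - 1))),
      0,
      m1 * (m3 * m4 - 1) * (m2 * m5 - 1) / ((m1 - 1) * (m3 - 1) * (m4 - 1)),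
      m3 * (m3 * m4 * m5 - 1) / ((m1 - 1) * (m3 - 1));
    -((m1 * m2 - 1) / ((m1 - 1) * (m2 - 1) * (m3 - 1))),
      0,
      m1 * (m1 * m2 * m5 - 1) / ((m1 - 1) * (m3 - 1)),
      m3 * (m1 * m2 - 1) * (m4 * m5 - 1) / ((m1 - 1) * (m2 - 1) * (m3 - 1))]

theorem det4 (a b c d e f g h i j k l : ℂ) :
    (!![a, b, c, d; e, f, 0, 0; g, 0, h, i; j, 0, k, l] : Matrix (Fin 4) (Fin 4) ℂ).det =
      (a * f - b * e) * (h * l - i * k) - f * (c * (g * l - i * j) - d * (g * k - h * j)) := by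
  simp [Matrix.det_succ_row_zero, Fin.sum_univ_succ, Fin.succAbove]
  ring

/-- Proposition 3.3: the determinant of the intersection matrix `H^μ`, and, under the
extra assumptions `μᵢ ≠ 0` (i = 1,…,4) and `μ₁μ₂μ₃μ₄μ₅ ≠ 1`, its invertibility. -/
theorem stmt12 (m1 m2 m3 m4 m5 : ℂ)
    (h1 : m1 ≠ 1) (h2 : m2 ≠ 1) (h3 : m3 ≠ 1) (h4 : m4 ≠ 1) (h5 : m5 ≠ 1) :
    (Hmu m1 m2 m3 m4 m5).det =
      m1 * m2 * m3 * m4 * (m5 - 1) * (m1 * m2 * m3 * m4 * m5 - 1) /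
        ((m1 - 1) ^ 2 * (m2 - 1) ^ 2 * (m3 - 1) ^ 2 * (m4 - 1) ^ 2) ∧
    ((m1 ≠ 0 ∧ m2 ≠ 0 ∧ m3 ≠ 0 ∧ m4 ≠ 0 ∧ m1 * m2 * m3 * m4 * m5 ≠ 1) →
      IsUnit (Hmu m1 m2 m3 m4 m5)) := by
  have a1 : m1 - 1 ≠ 0 := sub_ne_zero.mpr h1
  have a2 : m2 - 1 ≠ 0 := sub_ne_zero.mpr h2
  have a3 : m3 - 1 ≠ 0 := sub_ne_zero.mpr h3
  have a4 : m4 - 1 ≠ 0 := sub_ne_zero.mpr h4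
  have a5 : m5 - 1 ≠ 0 := sub_ne_zero.mpr h5
  have hdet : (Hmu m1 m2 m3 m4 m5).det =
      m1 * m2 * m3 * m4 * (m5 - 1) * (m1 * m2 * m3 * m4 * m5 - 1) /
        ((m1 - 1) ^ 2 * (m2 - 1) ^ 2 * (m3 - 1) ^ 2 * (m4 - 1) ^ 2) := by
    rw [Hmu, det4]
    field_simp
    ring
  refine ⟨hdet, ?_⟩
  rintro ⟨b1, b2, b3, b4, b5⟩
  rw [Matrix.isUnit_iff_isUnit_det, isUnit_iff_ne_zero, hdet]
  have b6 : m1 * m2 * m3 * m4 * m5 - 1 ≠ 0 := sub_ne_zero.mpr b5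
  positivity
end
end

section
/- Let n, k ∈ ℕ, let H be an n×n complex matrix, let R be a k×n complex matrix such that the k×k matrix C := R·H·Rᵀ is invertible, and let λ ∈ ℂ with λ ≠ 0. Define the n×n matrices M := λ·Iₙ − (λ−1)·H·Rᵀ·C^(−1)·R and M̃ := λ^(−1)·Iₙ − (λ^(−1)−1)·Rᵀ·C^(−1)·R·H. Then M·H·M̃ = H. (This is the relation M_i^μ H^μ M̃_i^{−μ} = H^μ of Corollary 3.9 for the circuit matrices i = 1, 2, where k = 2.) -/
/-- The relation `M_i^μ H^μ M̃_i^{−μ} = H^μ` of Corollary 3.9 for the circuit matrices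
(`i = 1, 2`): with `C = R·H·Rᵀ` invertible and `λ ≠ 0`, setting
`M = λ·I − (λ−1)·H·Rᵀ·C⁻¹·R` and `M̃ = λ⁻¹·I − (λ⁻¹−1)·Rᵀ·C⁻¹·R·H`,
one has `M H M̃ = H`. -/
theorem stmt14 (n k : ℕ) (H : Matrix (Fin n) (Fin n) ℂ)
    (R : Matrix (Fin k) (Fin n) ℂ)
    (C : Matrix (Fin k) (Fin k) ℂ) (hC : C = R * H * R.transpose) (hCunit : IsUnit C)
    (lam : ℂ) (hlam : lam ≠ 0)
    (M Mt : Matrix (Fin n) (Fin n) ℂ)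
    (hM : M = lam • (1 : Matrix (Fin n) (Fin n) ℂ) - (lam - 1) • (H * R.transpose * C⁻¹ * R))
    (hMt : Mt = lam⁻¹ • (1 : Matrix (Fin n) (Fin n) ℂ)
      - (lam⁻¹ - 1) • (R.transpose * C⁻¹ * R * H)) :
    M * H * Mt = H := by
  have hdet : IsUnit C.det := (Matrix.isUnit_iff_isUnit_det C).1 hCunit
  obtain ⟨P, hP⟩ : ∃ P, P = R.transpose * C⁻¹ * R := ⟨_, rfl⟩
  have hPHP : P * H * P = P := by
    have h1 : P * H * P = R.transpose * (C⁻¹ * (R * H * R.transpose)) * C⁻¹ * R := by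
      rw [hP]; simp only [Matrix.mul_assoc]
    rw [h1, ← hC, Matrix.nonsing_inv_mul _ hdet, Matrix.mul_one, ← hP]
  have e1 : H * R.transpose * C⁻¹ * R = H * P := by
    rw [hP]; simp only [Matrix.mul_assoc]
  have e3 : H * P * H * (P * H) = H * P * H := by
    have h2 : H * P * H * (P * H) = H * (P * H * P) * H := by
      simp only [Matrix.mul_assoc]
    rw [h2, hPHP]
  rw [hM, hMt, e1, ← hP]
  simp only [sub_mul, mul_sub, smul_mul_assoc, mul_smul_comm, one_mul, mul_one, e3]
  rw [← mul_assoc H P H]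
  match_scalars <;> field_simp
  ring
end
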